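/- arXiv:chao-dyn/9304005 — 11 statements merged into one kernel-verified Lean document; each statement's English description precedes it below -/
import Mathlib

section
/- Let n ≥ 1 and let M, R, Λ, S be real n×n matrices with M symmetric positive definite, R symmetric positive definite, S skew-symmetric, and Λ symmetric having at least one negative eigenvalue (i.e. qᵀΛq < 0 for some q). For ε ≥ 0 let A_ε be the 2n×2n real matrix given in n×n block form by A_ε = [[0, M⁻¹], [−Λ, −(S + εR)M⁻¹]], the first-order form of the damped gyroscopic system M q̈ + (S + εR) q̇ + Λ q = 0. Then there exists ε₀ > 0 such that for every ε with 0 < ε < ε₀, the matrix A_ε has a complex eigenvalue with strictly positive real part. -/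
open Matrix

open scoped InnerProductSpace

section LyapunovForm

variable {V U : Type*} [NormedAddCommGroup V] [InnerProductSpace ℂ V] [FiniteDimensional ℂ V]
  [NormedAddCommGroup U] [InnerProductSpace ℂ U]

/-- For a symmetric operator `H`, a vector whose `H`-pairing with the radical of `H` on `W`
vanishes can be corrected by an element of `W` to become `H`-orthogonal to `W`. -/
theorem LinearMap.IsSymmetric.exists_mem_forall_inner_sub_eq_zero {H : V →ₗ[ℂ] V}
    (hH : H.IsSymmetric) (W : Submodule ℂ V) (v : V)
    (hv : ∀ r ∈ W, (∀ x ∈ W, ⟪x, H r⟫_ℂ = 0) → ⟪r, H v⟫_ℂ = 0) :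
    ∃ w ∈ W, ∀ x ∈ W, ⟪x, H (v - w)⟫_ℂ = 0 := by
  let T : W →ₗ[ℂ] W := W.orthogonalProjectionOnto.toLinearMap ∘ₗ H ∘ₗ W.subtype
  have inner_proj (x : W) (y : V) : ⟪x, W.orthogonalProjectionOnto y⟫_ℂ = ⟪(x : V), y⟫_ℂ := by
    simp
  have hT : T.IsSymmetric := by
    intro x y
    rw [← inner_conj_symm]
    change starRingEnd ℂ ⟪y, W.orthogonalProjectionOnto (H x)⟫_ℂ
      = ⟪x, W.orthogonalProjectionOnto (H y)⟫_ℂ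
    rw [inner_proj, inner_proj, inner_conj_symm, hH]
  have hmem : W.orthogonalProjectionOnto (H v) ∈ T.range := by
    rw [← Submodule.orthogonal_orthogonal T.range, hT.orthogonal_range,
      Submodule.mem_orthogonal]
    intro r hr
    rw [inner_proj]
    refine hv r r.2 fun x hx => ?_
    have h : ⟪(⟨x, hx⟩ : W), T r⟫_ℂ = 0 := by
      rw [LinearMap.mem_ker.1 hr, inner_zero_right]
    rwa [show T r = W.orthogonalProjectionOnto (H r) from rfl, inner_proj] at h
  obtain ⟨w, hw⟩ := hmem
  refine ⟨w, w.2, fun x hx => ?_⟩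
  have h := inner_proj ⟨x, hx⟩ (H (v - w))
  rw [map_sub, map_sub, ← hw, show T w = W.orthogonalProjectionOnto (H w) from rfl, sub_self,
    inner_zero_right] at h
  rw [map_sub, ← h]

/-- An eigenvalue of the map induced on the quotient by an invariant subspace is an eigenvalue. -/
theorem Module.End.hasEigenvalue_of_apply_sub_smul_mem {A : Module.End ℂ V} {W : Submodule ℂ V}
    (hW : ∀ x ∈ W, A x ∈ W) {μ : ℂ} {v : V} (hv : v ∉ W) (hAv : A v - μ • v ∈ W) :
    A.HasEigenvalue μ := by
  by_contra hμ
  have hinj : ∀ x, A x = μ • x → x = 0 := by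
    intro x hx
    by_contra hx0
    exact hμ (Module.End.hasEigenvalue_of_hasEigenvector
      ⟨Module.End.mem_eigenspace_iff.2 hx, hx0⟩)
  have hB : ∀ x ∈ W, (A - μ • LinearMap.id : V →ₗ[ℂ] V) x ∈ W := fun x hx =>
    W.sub_mem (hW x hx) (W.smul_mem μ hx)
  have hsurj : Function.Surjective ((A - μ • LinearMap.id : V →ₗ[ℂ] V).restrict hB) := by
    rw [← LinearMap.injective_iff_surjective, injective_iff_map_eq_zero]
    intro x hx
    have h : A x - μ • (x : V) = 0 := congrArg Subtype.val hx
    exact Subtype.ext (hinj x (sub_eq_zero.1 h))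
  obtain ⟨w, hw⟩ := hsurj ⟨_, hAv⟩
  have h : A w - μ • (w : V) = A v - μ • v := congrArg Subtype.val hw
  have hvw : v - w = 0 := hinj _ (by
    rw [map_sub, smul_sub, sub_eq_sub_iff_sub_eq_sub, h])
  exact hv (sub_eq_zero.1 hvw ▸ w.2)

/-- If the Hermitian form of `H` decreases along `ẋ = A x` at rate `‖C x‖²`, the rate vanishes
identically only along equilibria in the kernel of `H`, and no eigenvalue of `A` has positive
real part, then `H` is positive semidefinite. -/
theorem LinearMap.IsSymmetric.re_inner_nonneg_of_dissipative {A H : V →ₗ[ℂ] V} {C : V →ₗ[ℂ] U}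
    (hH : H.IsSymmetric)
    (hdiss : ∀ x y, ⟪A x, H y⟫_ℂ + ⟪H x, A y⟫_ℂ = -⟪C x, C y⟫_ℂ)
    (hC : ∀ x, C x = 0 → C (A x) = 0 → H x = 0)
    (hA : ∀ μ, Module.End.HasEigenvalue A μ → μ.re ≤ 0) (x : V) :
    0 ≤ (⟪x, H x⟫_ℂ).re := by
  obtain ⟨W, ⟨hWA, hWH⟩, hmax⟩ := (wellFounded_gt (α := Submodule ℂ V)).has_min
    {W | (∀ x ∈ W, A x ∈ W) ∧ ∀ x ∈ W, 0 ≤ (⟪x, H x⟫_ℂ).re}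
    ⟨⊥, by simp, by simp⟩
  suffices hW : W = ⊤ from hWH x (hW ▸ Submodule.mem_top)
  by_contra hW
  have isotropic (r : V) (hr : r ∈ W) (h : ∀ x ∈ W, ⟪x, H r⟫_ℂ = 0) : C r = 0 := by
    have h1 := h _ (hWA r hr)
    have h2 := hdiss r r
    rw [← inner_conj_symm (H r), h1] at h2
    simpa using h2
  have pairing (v : V) (hv : ∀ x ∈ W, ⟪x, H v⟫_ℂ = 0) (hCv : C v = 0) :
      ∀ x ∈ W, ⟪x, H (A v)⟫_ℂ = 0 := by
    intro x hx
    have h := hdiss x v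
    rw [hv _ (hWA x hx), hCv, inner_zero_right, hH x] at h
    simpa using h
  have radical (r : V) (hr : r ∈ W) (h : ∀ x ∈ W, ⟪x, H r⟫_ℂ = 0) : H r = 0 :=
    hC r (isotropic r hr h)
      (isotropic _ (hWA r hr) (pairing r h (isotropic r hr h)))
  obtain ⟨μ, v, hvW, hAv⟩ : ∃ (μ : ℂ) (v : V), v ∉ W ∧ A v - μ • v ∈ W := by
    have : Nontrivial (V ⧸ W) := Submodule.Quotient.nontrivial_iff.2 hW
    obtain ⟨μ, hμ⟩ := Module.End.exists_eigenvalue (W.mapQ W A hWA)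
    obtain ⟨q, hq, hq0⟩ := hμ.exists_hasEigenvector
    obtain ⟨v, rfl⟩ := W.mkQ_surjective q
    refine ⟨μ, v, fun hv => hq0 ((Submodule.Quotient.mk_eq_zero W).2 hv), ?_⟩
    exact (Submodule.Quotient.eq W).1 (Module.End.mem_eigenspace_iff.1 hq)
  have hμ := hA μ (Module.End.hasEigenvalue_of_apply_sub_smul_mem hWA hvW hAv)
  obtain ⟨w, hw, hv⟩ := hH.exists_mem_forall_inner_sub_eq_zero W v fun r hr h => by
    rw [← hH, radical r hr h, inner_zero_left]
  obtain ⟨v, rfl⟩ : ∃ v', v' + w = v := ⟨v - w, sub_add_cancel v w⟩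
  rw [add_sub_cancel_right] at hv
  replace hvW : v ∉ W := fun h => hvW (W.add_mem h hw)
  replace hAv : A v - μ • v ∈ W := by
    have h := W.sub_mem hAv (W.sub_mem (hWA w hw) (W.smul_mem μ hw))
    rwa [show A (v + w) - μ • (v + w) - (A w - μ • w) = A v - μ • v by
      rw [map_add, smul_add]; abel] at h
  obtain ⟨u, hu, hAvu⟩ : ∃ u ∈ W, A v = μ • v + u := ⟨_, hAv, by abel⟩
  have hvv : 0 ≤ (⟪v, H v⟫_ℂ).re := by
    have h := hdiss v v
    rw [hH v, hAvu, inner_add_left, hv u hu, map_add, inner_add_right, ← hH v u,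
      ← inner_conj_symm (H v) u, hv u hu, map_smul, inner_smul_left, inner_smul_right,
      inner_self_eq_norm_sq_to_K] at h
    have him : (⟪v, H v⟫_ℂ).im = 0 := hH.im_inner_self_apply v
    have hre : 2 * (μ.re * (⟪v, H v⟫_ℂ).re) = -‖C v‖ ^ 2 := by
      have := congrArg Complex.re h
      simp [← Complex.ofReal_pow, him] at this
      linarith
    rcases hμ.lt_or_eq with hμ | hμ
    · nlinarith [sq_nonneg ‖C v‖]
    · have hCv : C v = 0 := by
        rw [hμ] at hre
        simpa using hre
      have hCu : C u = 0 := by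
        refine isotropic u hu fun x hx => ?_
        have h := pairing v hv hCv x hx
        rwa [hAvu, map_add, map_smul, inner_add_right, inner_smul_right, hv x hx, mul_zero,
          zero_add] at h
      rw [hC v hCv (by rw [hAvu, map_add, map_smul, hCv, hCu, smul_zero, add_zero]),
        inner_zero_right, Complex.zero_re]
  refine hmax (W ⊔ ℂ ∙ v) ⟨?_, ?_⟩ ?_
  · intro x hx
    obtain ⟨y, hy, z, hz, rfl⟩ := Submodule.mem_sup.1 hx
    obtain ⟨c, rfl⟩ := Submodule.mem_span_singleton.1 hz
    rw [map_add, map_smul, hAvu, smul_add, ← add_assoc, add_right_comm]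
    refine Submodule.mem_sup.2 ⟨A y + c • u, W.add_mem (hWA y hy) (W.smul_mem c hu),
      c • μ • v, ?_, by abel⟩
    exact Submodule.smul_mem _ _ (Submodule.smul_mem _ _ (Submodule.mem_span_singleton_self v))
  · intro x hx
    obtain ⟨y, hy, z, hz, rfl⟩ := Submodule.mem_sup.1 hx
    obtain ⟨c, rfl⟩ := Submodule.mem_span_singleton.1 hz
    have h1 : ⟪v, H y⟫_ℂ = 0 := by rw [← hH, ← inner_conj_symm, hv y hy, map_zero]
    have h2 : ⟪y + c • v, H (y + c • v)⟫_ℂ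
        = ⟪y, H y⟫_ℂ + (Complex.normSq c : ℂ) * ⟪v, H v⟫_ℂ := by
      rw [Complex.normSq_eq_conj_mul_self]
      simp only [map_add, map_smul, inner_add_left, inner_add_right, inner_smul_left,
        inner_smul_right, h1, hv y hy]
      ring
    rw [h2, Complex.add_re, Complex.re_ofReal_mul]
    exact add_nonneg (hWH y hy) (mul_nonneg (Complex.normSq_nonneg c) hvv)
  · refine lt_of_le_of_ne le_sup_left fun h => hvW ?_
    rw [h]
    exact Submodule.mem_sup_right (Submodule.mem_span_singleton_self v)

end LyapunovForm

/-- Matrix form of `LinearMap.IsSymmetric.re_inner_nonneg_of_dissipative`. -/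
theorem Matrix.IsHermitian.re_dotProduct_mulVec_nonneg_of_dissipative {m : Type*} [Fintype m]
    [DecidableEq m] {A H C : Matrix m m ℂ} (hH : H.IsHermitian)
    (hdiss : Aᴴ * H + H * A = -(Cᴴ * C))
    (hC : ∀ x, C *ᵥ x = 0 → C *ᵥ (A *ᵥ x) = 0 → H *ᵥ x = 0)
    (hA : ∀ μ, A.charpoly.IsRoot μ → μ.re ≤ 0) (x : m → ℂ) :
    0 ≤ (star x ⬝ᵥ H *ᵥ x).re := by
  have inner_mul (B D : Matrix m m ℂ) (x y : EuclideanSpace ℂ m) :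
      ⟪B.toEuclideanLin x, D.toEuclideanLin y⟫_ℂ
        = star x.ofLp ⬝ᵥ (Bᴴ * D) *ᵥ y.ofLp := by
    rw [EuclideanSpace.inner_eq_star_dotProduct, dotProduct_comm]
    simp [star_mulVec, dotProduct_mulVec, vecMul_vecMul]
  have h := LinearMap.IsSymmetric.re_inner_nonneg_of_dissipative (A := A.toEuclideanLin)
    (C := C.toEuclideanLin) (isSymmetric_toEuclideanLin_iff.2 hH) (fun x y => ?_)
    (fun x h1 h2 => ?_) (fun μ hμ => ?_) (WithLp.toLp 2 x)
  · rwa [EuclideanSpace.inner_eq_star_dotProduct, dotProduct_comm] at h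
  · rw [inner_mul, inner_mul, inner_mul, hH.eq, ← dotProduct_add, ← add_mulVec, hdiss,
      neg_mulVec, dotProduct_neg]
  · have h := hC x.ofLp (congrArg WithLp.ofLp h1) (congrArg WithLp.ofLp h2)
    exact congrArg (WithLp.toLp 2) h
  · refine hA μ (mem_spectrum_iff_isRoot_charpoly.1 ?_)
    rw [← spectrum_toLpLin 2]
    exact hμ.mem_spectrum

open scoped MatrixOrder Matrix.Norms.L2Operator in
/-- A positive definite matrix is a Gram matrix `Gᴴ * G` with `G` invertible. -/
theorem Matrix.PosDef.exists_isUnit_eq_conjTranspose_mul_self {m : Type*} [Fintype m]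
    [DecidableEq m] {P : Matrix m m ℝ} (hP : P.PosDef) :
    ∃ G : Matrix m m ℝ, IsUnit G ∧ P = Gᴴ * G :=
  CStarAlgebra.isStrictlyPositive_iff_eq_star_mul_self.mp hP.isStrictlyPositive

/-- **Dissipation induced instabilities, abelian case.**
If `M` is symmetric positive definite, `R` symmetric positive definite, `S` skew-symmetric
and the symmetric matrix `Λ` has at least one negative eigenvalue, then for all sufficiently
small `ε > 0` the matrix `A_ε = [[0, M⁻¹], [−Λ, −(S + εR)M⁻¹]]` of the damped gyroscopic
system `M q̈ + (S + εR) q̇ + Λ q = 0` has an eigenvalue with strictly positive real part. -/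
theorem dissipation_induced_instability_abelian
    (n : ℕ) (hn : 1 ≤ n)
    (M R Λ S : Matrix (Fin n) (Fin n) ℝ)
    (hM : M.PosDef) (hR : R.PosDef)
    (hS : Sᵀ = -S) (hΛ : Λᵀ = Λ)
    (hΛneg : ∃ q : Fin n → ℝ, q ⬝ᵥ Λ.mulVec q < 0) :
    ∃ ε₀ : ℝ, 0 < ε₀ ∧ ∀ ε : ℝ, 0 < ε → ε < ε₀ →
      ∃ μ : ℂ,
        (((fromBlocks 0 M⁻¹ (-Λ) (-((S + ε • R) * M⁻¹))).map
          Complex.ofReal).charpoly.IsRoot μ) ∧ 0 < μ.re := by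
  obtain ⟨q, hq⟩ := hΛneg
  refine ⟨1, one_pos, fun ε hε _ => ?_⟩
  by_contra! hroot
  set N := M⁻¹
  have hNpd : N.PosDef := hM.inv
  have hNt : Nᵀ = N := by simpa using hNpd.isHermitian.eq
  have hRt : Rᵀ = R := by simpa using hR.isHermitian.eq
  have hP : ((2 * ε) • (N * R * N)).PosDef := by
    refine PosDef.smul ?_ (by positivity)
    have h := hR.conjTranspose_mul_mul_same (B := N)
      (mulVec_injective_of_isUnit hNpd.isUnit)
    rwa [hNpd.isHermitian.eq] at h
  obtain ⟨G, hG, hPG⟩ := hP.exists_isUnit_eq_conjTranspose_mul_self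
  rw [conjTranspose_eq_transpose_of_trivial] at hPG
  set A := fromBlocks 0 N (-Λ) (-((S + ε • R) * N))
  let H : Matrix (Fin n ⊕ Fin n) (Fin n ⊕ Fin n) ℝ := fromBlocks Λ 0 0 N
  let C : Matrix (Fin n ⊕ Fin n) (Fin n ⊕ Fin n) ℝ := fromBlocks 0 0 0 G
  have hdiss : Aᵀ * H + H * A = -(Cᵀ * C) := by
    simp only [A, H, C, fromBlocks_transpose, fromBlocks_multiply, fromBlocks_add,
      fromBlocks_neg, ← hPG, transpose_neg, transpose_mul, transpose_add, transpose_smul, hNt,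
      hRt, hS, hΛ, transpose_zero]
    congr 1
    · simp
    · simp
    · simp
    · simp [mul_add, add_mul, two_mul, add_smul, mul_assoc]
      abel
  have hmap (B : Matrix (Fin n ⊕ Fin n) (Fin n ⊕ Fin n) ℝ) :
      (B.map Complex.ofReal)ᴴ = Bᵀ.map Complex.ofReal := by
    ext i j
    simp
  have hHt : Hᵀ = H := by simp [H, fromBlocks_transpose, hNt, hΛ]
  have h := Matrix.IsHermitian.re_dotProduct_mulVec_nonneg_of_dissipative
    (A := A.map Complex.ofReal) (H := H.map Complex.ofReal) (C := C.map Complex.ofReal)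
    (by rw [IsHermitian, hmap, hHt]) ?_ ?_ hroot (Complex.ofReal ∘ Sum.elim q 0)
  · have hre : (star (Complex.ofReal ∘ Sum.elim q 0)
        ⬝ᵥ H.map Complex.ofReal *ᵥ (Complex.ofReal ∘ Sum.elim q 0)).re = q ⬝ᵥ Λ *ᵥ q := by
      have hHv : H *ᵥ Sum.elim q 0 = Sum.elim (Λ *ᵥ q) 0 := by
        simp [H, fromBlocks_mulVec]
      have hmv : H.map Complex.ofReal *ᵥ (Complex.ofReal ∘ Sum.elim q 0)
          = Complex.ofReal ∘ (H *ᵥ Sum.elim q 0) :=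
        funext fun i => (RingHom.map_mulVec Complex.ofRealHom H _ i).symm
      rw [hmv, hHv]
      simp [dotProduct]
    exact absurd hq (not_lt.2 (hre ▸ h))
  · rw [hmap, hmap]
    have h := congrArg (Complex.ofRealHom.mapMatrix) hdiss
    simp only [map_add, map_mul, map_neg] at h
    exact h
  · intro x h1 h2
    have hG' : IsUnit (G.map Complex.ofReal) := hG.map (Complex.ofRealHom.mapMatrix)
    have hinj (y : Fin n → ℂ) (hy : G.map Complex.ofReal *ᵥ y = 0) : y = 0 :=
      mulVec_injective_of_isUnit hG' (hy.trans (mulVec_zero _).symm)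
    obtain ⟨y, z, rfl⟩ : ∃ y z, x = Sum.elim y z := ⟨_, _, (Sum.elim_comp_inl_inr x).symm⟩
    have hz : z = 0 := hinj z (by
      simpa [C, fromBlocks_map, fromBlocks_mulVec] using congrArg (· ∘ Sum.inr) h1)
    subst hz
    have hΛy : -Λ.map Complex.ofReal *ᵥ y = 0 := hinj _ (by
      simpa [A, C, fromBlocks_map, fromBlocks_mulVec, Matrix.map_neg] using
        congrArg (· ∘ Sum.inr) h2)
    rw [neg_mulVec, neg_eq_zero] at hΛy
    simp [H, fromBlocks_map, fromBlocks_mulVec, hΛy]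
end

section
/- Let α, β, g, γ, δ be real numbers with α < 0, β < 0, (g² + α + β)² − 4αβ > 0, g² + α + β > 0, γ ≥ 0, δ ≥ 0, and at least one of γ, δ strictly positive. Then the quartic polynomial p(λ) = λ⁴ + (γ + δ)λ³ + (g² + α + β + γδ)λ² + (γβ + δα)λ + αβ, regarded as a polynomial over ℂ, has exactly two roots (counted with multiplicity) with strictly positive real part. -/
open Polynomial

/-- A monic quadratic over `ℂ` with real coefficients has two roots that are either both real or
conjugate; here this is recorded through their real and imaginary parts. -/
theorem exists_roots_real_quadratic (p q : ℝ) :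
    ∃ u v : ℂ, (X ^ 2 + C (p : ℂ) * X + C (q : ℂ)) = (X - C u) * (X - C v) ∧
      u.re + v.re = -p ∧ u.re * v.re + u.im ^ 2 = q ∧ (u.im = 0 ∨ u.re = v.re) := by
  obtain ⟨u, hu⟩ := IsAlgClosed.exists_root (X ^ 2 + C (p : ℂ) * X + C (q : ℂ))
    (by rw [degree_eq_natDegree (isMonicOfDegree_add_add_two _ _).ne_zero,
          (isMonicOfDegree_add_add_two _ _).natDegree_eq]; norm_num)
  have hroot : u ^ 2 + p * u + q = 0 := by simpa using hu
  have hq : (q : ℂ) = u * (-p - u) := by linear_combination hroot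
  refine ⟨u, -p - u, ?_, ?_, ?_, ?_⟩
  · rw [hq]
    simp only [map_sub, map_neg, map_mul]
    ring
  · simp
  · have := congrArg Complex.re hq
    simp at this
    simp
    linarith
  · have := congrArg Complex.im hq
    simp at this
    simp only [Complex.sub_re, Complex.neg_re, Complex.ofReal_re]
    rw [← sub_eq_zero (a := u.re), ← mul_eq_zero]
    linarith

/-- The number of roots of `f` in the open right half plane, counted with multiplicity. -/
noncomputable def rhpCount (f : ℂ[X]) : ℕ :=
  Multiset.card (f.roots.filter fun z => 0 < z.re)

theorem rhpCount_mul {f h : ℂ[X]} (hfh : f * h ≠ 0) :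
    rhpCount (f * h) = rhpCount f + rhpCount h := by
  simp [rhpCount, roots_mul hfh]

theorem rhpCount_X_sub_C (u : ℂ) : rhpCount (X - C u) = if 0 < u.re then 1 else 0 := by
  rw [rhpCount, roots_X_sub_C, Multiset.filter_singleton]
  split_ifs <;> simp

theorem rhpCount_X_sub_C_mul (u v : ℂ) :
    rhpCount ((X - C u) * (X - C v)) =
      (if 0 < u.re then 1 else 0) + if 0 < v.re then 1 else 0 := by
  rw [rhpCount_mul (mul_ne_zero (X_sub_C_ne_zero u) (X_sub_C_ne_zero v)), rhpCount_X_sub_C,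
    rhpCount_X_sub_C]

theorem rhpCount_quadratic_of_pos_of_neg {p q : ℝ} (hq : 0 < q) (hp : p < 0) :
    rhpCount (X ^ 2 + C (p : ℂ) * X + C (q : ℂ)) = 2 := by
  obtain ⟨u, v, h, hs, hm, him⟩ := exists_roots_real_quadratic p q
  have huv : 0 < u.re ∧ 0 < v.re := by
    rcases him with h0 | h0
    · rw [h0] at hm
      constructor <;> by_contra! <;> nlinarith
    · constructor <;> linarith
  rw [h, rhpCount_X_sub_C_mul, if_pos huv.1, if_pos huv.2]

theorem rhpCount_quadratic_of_pos_of_pos {p q : ℝ} (hq : 0 < q) (hp : 0 < p) :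
    rhpCount (X ^ 2 + C (p : ℂ) * X + C (q : ℂ)) = 0 := by
  obtain ⟨u, v, h, hs, hm, him⟩ := exists_roots_real_quadratic p q
  have huv : ¬ 0 < u.re ∧ ¬ 0 < v.re := by
    rcases him with h0 | h0
    · rw [h0] at hm
      constructor <;> intro _ <;> nlinarith
    · constructor <;> linarith
  rw [h, rhpCount_X_sub_C_mul, if_neg huv.1, if_neg huv.2]

theorem rhpCount_quadratic_of_neg (p : ℝ) {q : ℝ} (hq : q < 0) :
    rhpCount (X ^ 2 + C (p : ℂ) * X + C (q : ℂ)) = 1 := by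
  obtain ⟨u, v, h, -, hm, -⟩ := exists_roots_real_quadratic p q
  have huv : u.re * v.re < 0 := by nlinarith [sq_nonneg u.im]
  rw [h, rhpCount_X_sub_C_mul]
  rcases mul_neg_iff.1 huv with ⟨hu, hv⟩ | ⟨hu, hv⟩
  · rw [if_pos hu, if_neg hv.not_gt]
  · rw [if_neg hu.not_gt, if_pos hv]

theorem exists_quadratic_mul_quadratic (a b c d : ℝ) :
    ∃ p q r s : ℝ, (X ^ 4 + C a * X ^ 3 + C b * X ^ 2 + C c * X + C d : ℝ[X]) =
      (X ^ 2 + C p * X + C q) * (X ^ 2 + C r * X + C s) := by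
  have hdeg : IsMonicOfDegree (X ^ 4 + C a * X ^ 3 + C b * X ^ 2 + C c * X + C d : ℝ[X]) 4 := by
    refine ⟨by compute_degree!, by monicity!⟩
  obtain ⟨f, h, hf, hh, hfh⟩ := hdeg.eq_isMonicOfDegree_two_mul_isMonicOfDegree
  obtain ⟨p, q, rfl⟩ := isMonicOfDegree_two_iff.1 hf
  obtain ⟨r, s, rfl⟩ := isMonicOfDegree_two_iff.1 hh
  exact ⟨p, q, r, s, hfh⟩

/-- A real monic quartic whose cubic, linear and constant coefficients have signs `+`, `-`, `+`
has exactly two roots in the open right half plane. -/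
theorem rhpCount_quartic {a c d : ℝ} (b : ℝ) (ha : 0 < a) (hc : c < 0) (hd : 0 < d) :
    rhpCount (X ^ 4 + C (a : ℂ) * X ^ 3 + C (b : ℂ) * X ^ 2 + C (c : ℂ) * X + C (d : ℂ)) = 2 := by
  obtain ⟨p, q, r, s, hfac⟩ := exists_quadratic_mul_quadratic a b c d
  have hexp : (X ^ 2 + C p * X + C q) * (X ^ 2 + C r * X + C s) =
      X ^ 4 + C (p + r) * X ^ 3 + C (q + s + p * r) * X ^ 2 + C (p * s + q * r) * X
        + C (q * s) := by
    simp only [map_add, map_mul]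
    ring
  have hcoeff := hfac.trans hexp
  have h3 : a = p + r := by
    simpa [coeff_X, coeff_C, -map_add, -map_mul] using
      congrArg (coeff · 3) hcoeff
  have h1 : c = p * s + q * r := by
    simpa [coeff_X, coeff_C, -map_add, -map_mul] using
      congrArg (coeff · 1) hcoeff
  have h0 : d = q * s := by
    simpa [coeff_X, coeff_C, -map_add, -map_mul] using
      congrArg (coeff · 0) hcoeff
  have hfacC := congrArg (Polynomial.map Complex.ofRealHom) hfac
  simp only [Polynomial.map_add, Polynomial.map_mul, Polynomial.map_pow, map_X, map_C,
    Complex.ofRealHom_eq_coe] at hfacC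
  rw [hfacC, rhpCount_mul (mul_ne_zero (isMonicOfDegree_add_add_two _ _).ne_zero
    (isMonicOfDegree_add_add_two _ _).ne_zero)]
  rcases mul_pos_iff.1 (h0 ▸ hd) with ⟨hq, hs⟩ | ⟨hq, hs⟩
  · rcases lt_or_ge p 0 with hp | hp
    · rw [rhpCount_quadratic_of_pos_of_neg hq hp,
        rhpCount_quadratic_of_pos_of_pos hs (by linarith)]
    · have hr : r < 0 := by
        by_contra! hr
        nlinarith [mul_nonneg hp hs.le, mul_nonneg hq.le hr]
      rw [rhpCount_quadratic_of_pos_of_neg hs hr,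
        rhpCount_quadratic_of_pos_of_pos hq (by linarith)]
  · rw [rhpCount_quadratic_of_neg p hq, rhpCount_quadratic_of_neg r hs]

/-- For the damped two-degree-of-freedom gyroscopic system
`ẍ − g ẏ + γ ẋ + α x = 0`, `ÿ + g ẋ + δ ẏ + β y = 0` with `α < 0`, `β < 0`,
discriminant `(g² + α + β)² − 4αβ > 0`, `g² + α + β > 0`, `γ, δ ≥ 0` and at least one of
`γ, δ` positive, the characteristic polynomial
`λ⁴ + (γ+δ)λ³ + (g²+α+β+γδ)λ² + (γβ+δα)λ + αβ` has exactly two roots (with multiplicity)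
in the strict right half plane. -/
theorem chetaev_system_two_rhp_roots
    (α β g γ δ : ℝ) (hα : α < 0) (hβ : β < 0)
    (hD : 0 < (g ^ 2 + α + β) ^ 2 - 4 * α * β) (hg : 0 < g ^ 2 + α + β)
    (hγ : 0 ≤ γ) (hδ : 0 ≤ δ) (hpos : 0 < γ ∨ 0 < δ) :
    Multiset.card
      ((((X ^ 4 + C ((γ : ℂ) + (δ : ℂ)) * X ^ 3
          + C ((g : ℂ) ^ 2 + (α : ℂ) + (β : ℂ) + (γ : ℂ) * (δ : ℂ)) * X ^ 2
          + C ((γ : ℂ) * (β : ℂ) + (δ : ℂ) * (α : ℂ)) * X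
          + C ((α : ℂ) * (β : ℂ))) : Polynomial ℂ).roots).filter
        (fun z => 0 < z.re)) = 2 := by
  have ha : 0 < γ + δ := by rcases hpos with h | h <;> linarith
  have hc : γ * β + δ * α < 0 := by
    rcases hpos with h | h
    · nlinarith [mul_neg_of_pos_of_neg h hβ, mul_nonpos_of_nonneg_of_nonpos hδ hα.le]
    · nlinarith [mul_neg_of_pos_of_neg h hα, mul_nonpos_of_nonneg_of_nonpos hγ hβ.le]
  have h := rhpCount_quartic (g ^ 2 + α + β + γ * δ) ha hc (mul_pos_of_neg_of_neg hα hβ)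
  push_cast at h
  exact h
end

section
/- Let n ≥ 1, let J be the standard 2n×2n symplectic matrix [[0, Iₙ], [−Iₙ, 0]], and let Q be a real symmetric invertible 2n×2n matrix whose number of negative eigenvalues (counted with multiplicity) is odd. Then the matrix L = JQ has a real eigenvalue λ with λ > 0. -/
open Matrix

/-- A finite product of nonzero reals with an odd number of negative factors is negative. -/
theorem prod_neg_of_odd_card_neg {ι : Type*} [Fintype ι] (f : ι → ℝ) (hf : ∏ i, f i ≠ 0)
    (hodd : Odd (Finset.univ.filter (fun i => f i < 0)).card) : ∏ i, f i < 0 := by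
  have hsplit : ∏ i, f i = (-1) ^ (Finset.univ.filter (fun i => f i < 0)).card * ∏ i, |f i| := by
    rw [← Finset.prod_const, Finset.prod_filter, ← Finset.prod_mul_distrib]
    refine Finset.prod_congr rfl fun i _ => ?_
    split_ifs with h
    · rw [abs_of_neg h]; ring
    · rw [abs_of_nonneg (not_lt.mp h), one_mul]
  have hpos : 0 < ∏ i, |f i| := by
    rw [← Finset.abs_prod]
    exact abs_pos.mpr hf
  rw [hsplit, hodd.neg_one_pow]
  linarith

/-- The standard symplectic matrix has determinant one. -/
theorem det_standard_symplectic (n : ℕ) :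
    (fromBlocks 0 1 (-1) 0 : Matrix (Fin n ⊕ Fin n) (Fin n ⊕ Fin n) ℝ).det = 1 := by
  have h : (fromBlocks 0 1 (-1) 0 : Matrix (Fin n ⊕ Fin n) (Fin n ⊕ Fin n) ℝ)
      = (Matrix.J (Fin n) ℝ)ᵀ := by
    simp [Matrix.J, fromBlocks_transpose]
  rw [h, det_transpose]
  exact SymplecticGroup.det_eq_one (SymplecticGroup.J_mem (l := Fin n) (R := ℝ))

/-- A real monic polynomial that is negative at zero has a strictly positive root. -/
theorem exists_pos_root_of_monic_of_eval_zero_neg {p : Polynomial ℝ} (hp : p.Monic)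
    (h0 : p.eval 0 < 0) : ∃ x, 0 < x ∧ p.IsRoot x := by
  have hdeg : 0 < p.degree := by
    rw [hp.degree_pos]
    rintro rfl
    norm_num at h0
  have hlim := p.tendsto_atTop_of_leadingCoeff_nonneg hdeg (by simp [hp.leadingCoeff])
  obtain ⟨b, hb, hb0⟩ :=
    ((hlim.eventually_gt_atTop 0).and (Filter.eventually_gt_atTop 0)).exists
  obtain ⟨x, hx, hroot⟩ :=
    intermediate_value_Ioo hb0.le p.continuous.continuousOn ⟨h0, hb⟩
  exact ⟨x, hx.1, hroot⟩




/-- If `Q` is a real symmetric invertible `2n×2n` matrix with an odd number of negative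
eigenvalues (odd index), then `L = JQ`, with `J` the standard symplectic matrix, has a
real strictly positive eigenvalue. -/
theorem odd_index_real_positive_eigenvalue
    (n : ℕ) (hn : 1 ≤ n)
    (Q : Matrix (Fin n ⊕ Fin n) (Fin n ⊕ Fin n) ℝ)
    (hQ : Q.IsHermitian) (hQinv : IsUnit Q.det)
    (hodd : Odd (Finset.univ.filter (fun i => hQ.eigenvalues i < 0)).card) :
    ∃ μ : ℂ, μ.im = 0 ∧ 0 < μ.re ∧
      (((fromBlocks 0 1 (-1) 0 : Matrix (Fin n ⊕ Fin n) (Fin n ⊕ Fin n) ℝ) * Q).map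
        Complex.ofReal).charpoly.IsRoot μ := by
  have hdet : Q.det = ∏ i, hQ.eigenvalues i := by simpa using hQ.det_eq_prod_eigenvalues
  have hneg : Q.det < 0 := by
    rw [hdet]
    exact prod_neg_of_odd_card_neg _ (hdet ▸ hQinv.ne_zero) hodd
  have heval : (((fromBlocks 0 1 (-1) 0 : Matrix (Fin n ⊕ Fin n) (Fin n ⊕ Fin n) ℝ) *
      Q).charpoly).eval 0 < 0 := by
    rw [eval_charpoly, map_zero, zero_sub, det_neg, det_mul, det_standard_symplectic, one_mul]
    simpa using hneg
  obtain ⟨x, hx, hroot⟩ := exists_pos_root_of_monic_of_eval_zero_neg (charpoly_monic _) heval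
  refine ⟨x, Complex.ofReal_im x, by simpa using hx, ?_⟩
  have hmap := charpoly_map ((fromBlocks 0 1 (-1) 0 :
    Matrix (Fin n ⊕ Fin n) (Fin n ⊕ Fin n) ℝ) * Q) Complex.ofRealHom
  have hroot' := hroot.map (f := Complex.ofRealHom)
  rw [← hmap] at hroot'
  exact hroot'
end

section
/- Let α < 0, β < 0, and g be real numbers, set D = (g² + α + β)² − 4αβ, and let p₀(λ) = λ⁴ + (g² + α + β)λ² + αβ regarded as a polynomial over ℂ. Then: (a) if D < 0, p₀ has exactly two roots (with multiplicity) with strictly positive real part and exactly two with strictly negative real part; (c) if D > 0 and g² + α + β > 0, then every root of p₀ is purely imaginary and nonzero (all four roots lie on the imaginary axis away from 0). -/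
open Polynomial

/-- A real biquadratic `X⁴ + sX² + p` with `s² < 4p` has roots `±z`, `±conj z` with `0 < z.re`. -/
theorem exists_roots_biquadratic {s p : ℝ} (h : s ^ 2 < 4 * p) :
    ∃ u v : ℝ, 0 < u ∧
      (X ^ 4 + C (s : ℂ) * X ^ 2 + C (p : ℂ) : Polynomial ℂ).roots =
        {(⟨u, v⟩ : ℂ), ⟨u, -v⟩, ⟨-u, v⟩, ⟨-u, -v⟩} := by
  have hp : 0 ≤ p := by nlinarith [sq_nonneg s]
  have hq : √p ^ 2 = p := Real.sq_sqrt hp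
  have hs : |s| < 2 * √p := abs_lt_of_sq_lt_sq (by nlinarith) (by positivity)
  obtain ⟨hs₁, hs₂⟩ := abs_lt.mp hs
  have hu : √(2 * √p - s) ^ 2 = 2 * √p - s := Real.sq_sqrt (by linarith)
  have hv : √(2 * √p + s) ^ 2 = 2 * √p + s := Real.sq_sqrt (by linarith)
  have hu_pos : 0 < √(2 * √p - s) := Real.sqrt_pos.mpr (by linarith)
  set u := √(2 * √p - s) / 2 with hu_def
  set v := √(2 * √p + s) / 2 with hv_def
  have hs_eq : s = 2 * (v ^ 2 - u ^ 2) := by rw [hu_def, hv_def]; linarith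
  have hp_eq : p = (u ^ 2 + v ^ 2) ^ 2 := by
    have : u ^ 2 + v ^ 2 = √p := by rw [hu_def, hv_def]; linarith
    rw [this, hq]
  refine ⟨u, v, by positivity, ?_⟩
  have hfactor : (X ^ 4 + C (s : ℂ) * X ^ 2 + C (p : ℂ) : Polynomial ℂ) =
      (({(⟨u, v⟩ : ℂ), ⟨u, -v⟩, ⟨-u, v⟩, ⟨-u, -v⟩} : Multiset ℂ).map fun a => X - C a).prod := by
    have hI : (C Complex.I : Polynomial ℂ) ^ 2 = -1 := by rw [← C_pow, Complex.I_sq]; simp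
    have hI4 : (C Complex.I : Polynomial ℂ) ^ 4 = 1 := by
      rw [← C_pow, Complex.I_pow_four, C_1]
    rw [hs_eq, hp_eq]
    simp only [Multiset.insert_eq_cons, Multiset.map_cons, Multiset.map_singleton,
      Multiset.prod_cons, Multiset.prod_singleton, Complex.mk_eq_add_mul_I]
    push_cast
    simp only [map_add, map_sub, map_mul, map_pow, map_neg, map_ofNat]
    ring_nf
    simp only [hI, hI4]
    ring
  rw [hfactor, roots_multiset_prod_X_sub_C]

/-- If `s, p > 0` and `4p < s²`, every root of `z⁴ + sz² + p` is purely imaginary and nonzero. -/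
theorem re_eq_zero_of_biquadratic_root {s p : ℝ} (hs : 0 < s) (hp : 0 < p)
    (h : 4 * p < s ^ 2) {z : ℂ} (hz : z ^ 4 + s * z ^ 2 + p = 0) : z.re = 0 ∧ z ≠ 0 := by
  constructor
  · obtain ⟨a, b⟩ := z
    have hw : ((⟨a, b⟩ : ℂ) ^ 2) = ⟨a ^ 2 - b ^ 2, 2 * a * b⟩ := by
      apply Complex.ext <;> simp [sq]; ring
    rw [show (4 : ℕ) = 2 * 2 from rfl, pow_mul, hw, Complex.ext_iff] at hz
    simp only [sq, Complex.add_re, Complex.add_im, Complex.mul_re, Complex.mul_im,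
      Complex.ofReal_re, Complex.ofReal_im, Complex.zero_re, Complex.zero_im] at hz
    obtain ⟨hre, him⟩ := hz
    by_contra ha
    replace ha : a ≠ 0 := ha
    have ha2 : 0 < a ^ 2 := by positivity
    have him' : a * (b * (2 * (a ^ 2 - b ^ 2) + s)) = 0 := by linarith
    rcases mul_eq_zero.mp ((mul_eq_zero.mp him').resolve_left ha) with hb | hx
    · subst hb
      nlinarith [mul_pos hs ha2, sq_nonneg (a ^ 2)]
    · have hx' : a ^ 2 - b ^ 2 = -s / 2 := by linarith
      simp only [← sq, hx'] at hre
      nlinarith [sq_nonneg (2 * a * b)]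
  · rintro rfl
    have : (p : ℂ) = 0 := by simpa using hz
    exact hp.ne' (by exact_mod_cast this)

/-- Root configuration of the undamped gyroscopic characteristic polynomial
`p₀(λ) = λ⁴ + (g²+α+β)λ² + αβ` with `α < 0`, `β < 0`:
(a) if `D = (g²+α+β)² − 4αβ < 0` there are exactly two roots in each open half plane;
(c) if `D > 0` and `g²+α+β > 0`, all roots are purely imaginary and nonzero. -/
theorem undamped_gyroscopic_root_configuration
    (α β g : ℝ) (hα : α < 0) (hβ : β < 0) :
    ((g ^ 2 + α + β) ^ 2 - 4 * α * β < 0 →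
      Multiset.card
        ((((X ^ 4 + C ((g : ℂ) ^ 2 + (α : ℂ) + (β : ℂ)) * X ^ 2
            + C ((α : ℂ) * (β : ℂ))) : Polynomial ℂ).roots).filter
          (fun z => 0 < z.re)) = 2 ∧
      Multiset.card
        ((((X ^ 4 + C ((g : ℂ) ^ 2 + (α : ℂ) + (β : ℂ)) * X ^ 2
            + C ((α : ℂ) * (β : ℂ))) : Polynomial ℂ).roots).filter
          (fun z => z.re < 0)) = 2) ∧
    (0 < (g ^ 2 + α + β) ^ 2 - 4 * α * β → 0 < g ^ 2 + α + β →
      ∀ z ∈ (((X ^ 4 + C ((g : ℂ) ^ 2 + (α : ℂ) + (β : ℂ)) * X ^ 2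
          + C ((α : ℂ) * (β : ℂ))) : Polynomial ℂ).roots),
        z.re = 0 ∧ z ≠ 0) := by
  have hs : (g : ℂ) ^ 2 + (α : ℂ) + (β : ℂ) = ((g ^ 2 + α + β : ℝ) : ℂ) := by push_cast; rfl
  have hp : (α : ℂ) * (β : ℂ) = ((α * β : ℝ) : ℂ) := by push_cast; rfl
  rw [hs, hp]
  refine ⟨fun hD => ?_, fun hD hpos z hz => ?_⟩
  · obtain ⟨u, v, hu, hroots⟩ :=
      exists_roots_biquadratic (s := g ^ 2 + α + β) (p := α * β) (by linarith)
    rw [hroots]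
    constructor <;>
      simp [Multiset.insert_eq_cons, Multiset.filter_singleton, hu, hu.not_gt]
  · refine re_eq_zero_of_biquadratic_root hpos (mul_pos_of_neg_of_neg hα hβ) (by linarith) ?_
    simpa using isRoot_of_mem_roots hz
end

section
/- (Chetaev function construction) Let M, R, K be real symmetric positive definite n×n matrices, S real skew-symmetric, and Λ real symmetric and invertible. Let A = [[0, M⁻¹], [−Λ, −(S + R)M⁻¹]] in n×n block form, and for β ∈ ℝ let Q_β = [[Λ, (β/2)ΛK⁻¹], [(β/2)K⁻¹Λ, M⁻¹]] be the symmetric matrix of the quadratic form W(q,p) = ½ pᵀM⁻¹p + ½ qᵀΛq + β qᵀΛK⁻¹p. Then there exists β₀ > 0 such that for all β with 0 < β < β₀: (1) the symmetric matrix AᵀQ_β + Q_β A is negative definite; and (2) if Λ has a negative eigenvalue then there exists z ∈ ℝ²ⁿ with zᵀQ_β z < 0. -/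
open Matrix

section QuadraticForm

variable {ι : Type*} [Fintype ι]

theorem dotProduct_mulVec_comm_transpose (A : Matrix ι ι ℝ) (x y : ι → ℝ) :
    x ⬝ᵥ A *ᵥ y = y ⬝ᵥ Aᵀ *ᵥ x := by
  rw [mulVec_transpose, dotProduct_mulVec, dotProduct_comm]

theorem Matrix.PosDef.dotProduct_mulVec_self_pos {A : Matrix ι ι ℝ} (hA : A.PosDef) {x : ι → ℝ}
    (hx : x ≠ 0) : 0 < x ⬝ᵥ A *ᵥ x := by
  simpa using hA.dotProduct_mulVec_pos hx

theorem dotProduct_mulVec_self_eq_zero_of_skew {S : Matrix ι ι ℝ} (hS : Sᵀ = -S) (x : ι → ℝ) :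
    x ⬝ᵥ S *ᵥ x = 0 := by
  have h := dotProduct_mulVec_comm_transpose S x x
  rw [hS, neg_mulVec, dotProduct_neg] at h
  linarith

/-- A positive definite quadratic form dominates every sufficiently small multiple of any other
quadratic form. -/
theorem Matrix.PosDef.exists_smul_quadratic_lt {R : Matrix ι ι ℝ} (hR : R.PosDef)
    (E : Matrix ι ι ℝ) :
    ∃ ε : ℝ, 0 < ε ∧ ∀ β : ℝ, 0 < β → β < ε → ∀ v : ι → ℝ, v ≠ 0 →
      β * (v ⬝ᵥ E *ᵥ v) < v ⬝ᵥ R *ᵥ v := by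
  have hcont : ContinuousOn (fun v : ι → ℝ => (v ⬝ᵥ E *ᵥ v) / (v ⬝ᵥ R *ᵥ v))
      (Metric.sphere 0 1) := by
    refine ContinuousOn.div (by fun_prop) (by fun_prop) fun v hv => ?_
    exact (hR.dotProduct_mulVec_self_pos (ne_zero_of_mem_unit_sphere ⟨v, hv⟩)).ne'
  obtain ⟨C, hC⟩ := (isCompact_sphere (0 : ι → ℝ) 1).exists_bound_of_continuousOn hcont
  refine ⟨1 / (|C| + 1), by positivity, fun β hβ hβε v hv => ?_⟩
  have hpos := hR.dotProduct_mulVec_self_pos hv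
  have hnorm : ‖v‖ ≠ 0 := norm_ne_zero_iff.mpr hv
  have hmem : ‖v‖⁻¹ • v ∈ Metric.sphere (0 : ι → ℝ) 1 := by
    simp [norm_smul, hnorm]
  have hratio := (le_abs_self _).trans ((hC _ hmem).trans (le_abs_self C))
  simp only [mulVec_smul, smul_dotProduct, dotProduct_smul, smul_eq_mul] at hratio
  rw [mul_div_mul_left _ _ (inv_ne_zero hnorm), mul_div_mul_left _ _ (inv_ne_zero hnorm),
    div_le_iff₀ hpos] at hratio
  rw [lt_div_iff₀ (by positivity)] at hβε
  nlinarith [mul_le_mul_of_nonneg_left hratio hβ.le, mul_pos hβ hpos]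

/-- Young's inequality for a positive semidefinite bilinear form. -/
theorem Matrix.PosSemidef.neg_dotProduct_mulVec_le {A : Matrix ι ι ℝ} (hA : A.PosSemidef)
    (x y : ι → ℝ) :
    -(x ⬝ᵥ A *ᵥ y) ≤ (x ⬝ᵥ A *ᵥ x + y ⬝ᵥ A *ᵥ y) / 2 := by
  have h : 0 ≤ (x + y) ⬝ᵥ A *ᵥ (x + y) := by
    simpa using hA.dotProduct_mulVec_nonneg (x + y)
  have hsymm : y ⬝ᵥ A *ᵥ x = x ⬝ᵥ A *ᵥ y := by
    have hT : Aᵀ = A := by simpa using hA.isHermitian.eq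
    rw [dotProduct_mulVec_comm_transpose, hT]
  simp only [mulVec_add, add_dotProduct, dotProduct_add, hsymm] at h
  linarith

/-- The Lyapunov derivative of a symmetric quadratic form. -/
theorem dotProduct_lyapunov_mulVec {A Q : Matrix ι ι ℝ} (hQ : Qᵀ = Q) (z : ι → ℝ) :
    z ⬝ᵥ (Aᵀ * Q + Q * A) *ᵥ z = 2 * ((A *ᵥ z) ⬝ᵥ (Q *ᵥ z)) := by
  have h₁ : z ⬝ᵥ Aᵀ *ᵥ (Q *ᵥ z) = (A *ᵥ z) ⬝ᵥ (Q *ᵥ z) := by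
    rw [dotProduct_mulVec, vecMul_transpose]
  have h₂ : z ⬝ᵥ Q *ᵥ (A *ᵥ z) = (A *ᵥ z) ⬝ᵥ (Q *ᵥ z) := by
    rw [dotProduct_mulVec_comm_transpose, hQ]
  rw [add_mulVec, dotProduct_add, ← mulVec_mulVec, ← mulVec_mulVec, h₁, h₂]
  ring

end QuadraticForm

section Chetaev

variable {n : ℕ} {M R K Λ S : Matrix (Fin n) (Fin n) ℝ}

/-- Half of the derivative of the Chetaev form along the flow, in terms of the velocity
`v = M⁻¹ p` and the force `Λ q`. -/
theorem dotProduct_chetaev_derivative (hM : IsUnit M.det) (hK : (K⁻¹)ᵀ = K⁻¹) (hS : Sᵀ = -S)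
    (β : ℝ) (q v : Fin n → ℝ) :
    (fromBlocks 0 M⁻¹ (-Λ) (-((S + R) * M⁻¹)) *ᵥ Sum.elim q (M *ᵥ v)) ⬝ᵥ
        (fromBlocks Λ ((β / 2) • (Λ * K⁻¹)) ((β / 2) • (K⁻¹ * Λ)) M⁻¹ *ᵥ
          Sum.elim q (M *ᵥ v)) =
      β / 2 * (v ⬝ᵥ (Λ * K⁻¹ * M) *ᵥ v - (Λ *ᵥ q) ⬝ᵥ K⁻¹ *ᵥ (Λ *ᵥ q)
        - (Λ *ᵥ q) ⬝ᵥ K⁻¹ *ᵥ ((S + R) *ᵥ v)) - v ⬝ᵥ R *ᵥ v := by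
  have hMv : M⁻¹ *ᵥ (M *ᵥ v) = v := by
    rw [mulVec_mulVec, nonsing_inv_mul _ hM, one_mulVec]
  have hcross : ((S + R) *ᵥ v) ⬝ᵥ K⁻¹ *ᵥ (Λ *ᵥ q) =
      (Λ *ᵥ q) ⬝ᵥ K⁻¹ *ᵥ ((S + R) *ᵥ v) := by
    rw [dotProduct_mulVec_comm_transpose, hK]
  have hdiss : ((S + R) *ᵥ v) ⬝ᵥ v = v ⬝ᵥ R *ᵥ v := by
    rw [dotProduct_comm, add_mulVec, dotProduct_add,
      dotProduct_mulVec_self_eq_zero_of_skew hS, zero_add]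
  simp only [fromBlocks_mulVec, Sum.elim_comp_inl, Sum.elim_comp_inr,
    sumElim_dotProduct_sumElim, zero_mulVec, zero_add, neg_mulVec, smul_mulVec,
    ← mulVec_mulVec, hMv, add_dotProduct, dotProduct_add, neg_dotProduct, dotProduct_smul,
    smul_eq_mul]
  simp only [hcross, hdiss, dotProduct_comm (Λ *ᵥ q) v]
  ring

end Chetaev

/-- **Chetaev function construction.** For the damped gyroscopic system
`A = [[0, M⁻¹], [−Λ, −(S + R)M⁻¹]]` with `M`, `R`, `K` symmetric positive definite,
`S` skew and `Λ` symmetric invertible, the Chetaev quadratic form with matrix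
`Q_β = [[Λ, (β/2)ΛK⁻¹], [(β/2)K⁻¹Λ, M⁻¹]]` (in the ordering `(q, p)`) satisfies, for all
sufficiently small `β > 0`: (1) `AᵀQ_β + Q_βA` is negative definite; (2) if `Λ` has a
negative eigenvalue then `Q_β` has a negative direction. -/
theorem chetaev_function_construction
    (n : ℕ) (M R K Λ S : Matrix (Fin n) (Fin n) ℝ)
    (hM : M.PosDef) (hR : R.PosDef) (hK : K.PosDef)
    (hS : Sᵀ = -S) (hΛ : Λᵀ = Λ) (hΛinv : IsUnit Λ.det) :
    ∃ β₀ : ℝ, 0 < β₀ ∧ ∀ β : ℝ, 0 < β → β < β₀ →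
      (∀ z : Fin n ⊕ Fin n → ℝ, z ≠ 0 →
        z ⬝ᵥ ((fromBlocks 0 M⁻¹ (-Λ) (-((S + R) * M⁻¹)))ᵀ *
              (fromBlocks Λ ((β / 2) • (Λ * K⁻¹)) ((β / 2) • (K⁻¹ * Λ)) M⁻¹) +
            (fromBlocks Λ ((β / 2) • (Λ * K⁻¹)) ((β / 2) • (K⁻¹ * Λ)) M⁻¹) *
              (fromBlocks 0 M⁻¹ (-Λ) (-((S + R) * M⁻¹)))).mulVec z < 0) ∧
      ((∃ q : Fin n → ℝ, q ⬝ᵥ Λ.mulVec q < 0) →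
        ∃ z : Fin n ⊕ Fin n → ℝ,
          z ⬝ᵥ (fromBlocks Λ ((β / 2) • (Λ * K⁻¹)) ((β / 2) • (K⁻¹ * Λ)) M⁻¹).mulVec z
            < 0) := by
  have hMu : IsUnit M.det := hM.det_pos.ne'.isUnit
  have hKT : (K⁻¹)ᵀ = K⁻¹ := by simpa using hK.inv.isHermitian.eq
  have hMT : (M⁻¹)ᵀ = M⁻¹ := by simpa using hM.inv.isHermitian.eq
  obtain ⟨ε, hε, hlt⟩ := hR.exists_smul_quadratic_lt
    (Λ * K⁻¹ * M + (1 / 2 : ℝ) • ((S + R)ᵀ * K⁻¹ * (S + R)))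
  refine ⟨ε, hε, fun β hβ hβε => ⟨fun z hz => ?_, ?_⟩⟩
  · have hQ : (fromBlocks Λ ((β / 2) • (Λ * K⁻¹)) ((β / 2) • (K⁻¹ * Λ)) M⁻¹)ᵀ =
        fromBlocks Λ ((β / 2) • (Λ * K⁻¹)) ((β / 2) • (K⁻¹ * Λ)) M⁻¹ := by
      simp only [fromBlocks_transpose, transpose_smul, transpose_mul, hΛ, hKT, hMT]
    obtain ⟨q, v, rfl⟩ : ∃ q v, z = Sum.elim q (M *ᵥ v) := by
      refine ⟨z ∘ Sum.inl, M⁻¹ *ᵥ (z ∘ Sum.inr), ?_⟩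
      rw [mulVec_mulVec, mul_nonsing_inv _ hMu, one_mulVec, Sum.elim_comp_inl_inr]
    rw [dotProduct_lyapunov_mulVec hQ, dotProduct_chetaev_derivative hMu hKT hS]
    have hyoung := hK.inv.posSemidef.neg_dotProduct_mulVec_le (Λ *ᵥ q) ((S + R) *ᵥ v)
    by_cases hv : v = 0
    · subst hv
      have hq : Λ *ᵥ q ≠ 0 := fun h => hz <| by
        rw [eq_zero_of_mulVec_eq_zero hΛinv.ne_zero h, mulVec_zero, Sum.elim_zero_zero]
      have hpos := mul_pos hβ (hK.inv.dotProduct_mulVec_self_pos hq)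
      simp only [mulVec_zero, dotProduct_zero]
      linarith
    · have hnonneg : 0 ≤ (Λ *ᵥ q) ⬝ᵥ K⁻¹ *ᵥ (Λ *ᵥ q) := by
        simpa using hK.inv.posSemidef.dotProduct_mulVec_nonneg (Λ *ᵥ q)
      have hE := hlt β hβ hβε v hv
      have hRv := hR.dotProduct_mulVec_self_pos hv
      have hD : v ⬝ᵥ ((S + R)ᵀ * K⁻¹ * (S + R)) *ᵥ v =
          ((S + R) *ᵥ v) ⬝ᵥ K⁻¹ *ᵥ ((S + R) *ᵥ v) := by
        rw [mul_assoc, ← mulVec_mulVec, dotProduct_mulVec, vecMul_transpose, ← mulVec_mulVec]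
      rw [add_mulVec, smul_mulVec, dotProduct_add, dotProduct_smul, smul_eq_mul, hD] at hE
      nlinarith [mul_le_mul_of_nonneg_left hyoung hβ.le, mul_nonneg hβ.le hnonneg]
  · rintro ⟨q, hq⟩
    refine ⟨Sum.elim q 0, ?_⟩
    simpa [fromBlocks_mulVec, sumElim_dotProduct_sumElim] using hq
end

section
/- Let A be a real m×m matrix and Q a real symmetric m×m matrix, and define V(x) = ½ xᵀQx and V̇(x) = ½ xᵀ(AᵀQ + QA)x for x ∈ ℝᵐ. Let λ ∈ ℂ be an eigenvalue of A with eigenvector ξ = x_r + i x_i, where x_r, x_i ∈ ℝᵐ and ξ ≠ 0. If V(x_r) + V(x_i) ≠ 0, then Re λ = (V̇(x_r) + V̇(x_i)) / (2 (V(x_r) + V(x_i))). -/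
open Matrix

/-- The real and imaginary parts of the eigenvector equation of a real matrix. -/
theorem mulVec_re_im_of_eigenvector {n : Type*} [Fintype n] {A : Matrix n n ℝ} {z : ℂ}
    {x y : n → ℝ}
    (h : (A.map Complex.ofReal).mulVec (fun j => (x j : ℂ) + (y j : ℂ) * Complex.I)
      = z • fun j => (x j : ℂ) + (y j : ℂ) * Complex.I) :
    A.mulVec x = z.re • x - z.im • y ∧ A.mulVec y = z.im • x + z.re • y := by
  constructor
  · ext j
    have := congrArg Complex.re (congrFun h j)
    simpa [mulVec, dotProduct] using this
  · ext j
    have := congrArg Complex.im (congrFun h j)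
    simpa [mulVec, dotProduct, add_comm] using this

/-- For symmetric `Q`, the quadratic form of `AᵀQ + QA` is twice that of `QA`. -/
theorem dotProduct_lyapunov_mulVec_s13 {n R : Type*} [Fintype n] [CommRing R]
    (A : Matrix n n R) {Q : Matrix n n R} (hQ : Qᵀ = Q) (x : n → R) :
    x ⬝ᵥ (Aᵀ * Q + Q * A).mulVec x = 2 * (x ⬝ᵥ Q.mulVec (A.mulVec x)) := by
  have h : x ⬝ᵥ (Aᵀ * Q).mulVec x = x ⬝ᵥ (Q * A).mulVec x := by
    rw [← dotProduct_transpose_mulVec, transpose_mul, transpose_transpose, hQ]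
  rw [add_mulVec, dotProduct_add, h, mulVec_mulVec, two_mul]

/-- **Lemma 5.1 of the paper.** For the quadratic function `V(x) = ½ xᵀQx` with
derivative `V̇(x) = ½ xᵀ(AᵀQ + QA)x` along `ẋ = Ax`, and an eigenvalue `λ` of `A` with
eigenvector `ξ = x_r + i x_i`, one has
`Re λ = (V̇(x_r) + V̇(x_i)) / (2(V(x_r) + V(x_i)))` whenever the denominator is nonzero. -/
theorem real_part_eigenvalue_formula
    (m : ℕ) (A Q : Matrix (Fin m) (Fin m) ℝ) (hQ : Qᵀ = Q)
    (lam : ℂ) (xr xi : Fin m → ℝ)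
    (hξne : (fun j => (xr j : ℂ) + (xi j : ℂ) * Complex.I) ≠ 0)
    (heig : (A.map Complex.ofReal).mulVec (fun j => (xr j : ℂ) + (xi j : ℂ) * Complex.I)
      = lam • fun j => (xr j : ℂ) + (xi j : ℂ) * Complex.I)
    (hden : (1 / 2) * (xr ⬝ᵥ Q.mulVec xr) + (1 / 2) * (xi ⬝ᵥ Q.mulVec xi) ≠ 0) :
    lam.re =
      ((1 / 2) * (xr ⬝ᵥ (Aᵀ * Q + Q * A).mulVec xr)
          + (1 / 2) * (xi ⬝ᵥ (Aᵀ * Q + Q * A).mulVec xi))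
        / (2 * ((1 / 2) * (xr ⬝ᵥ Q.mulVec xr) + (1 / 2) * (xi ⬝ᵥ Q.mulVec xi))) := by
  obtain ⟨hr, hi⟩ := mulVec_re_im_of_eigenvector heig
  have hsymm : xi ⬝ᵥ Q.mulVec xr = xr ⬝ᵥ Q.mulVec xi := by
    rw [← dotProduct_transpose_mulVec, hQ]
  rw [eq_div_iff (mul_ne_zero two_ne_zero hden), dotProduct_lyapunov_mulVec_s13 A hQ,
    dotProduct_lyapunov_mulVec_s13 A hQ, hr, hi]
  simp only [mulVec_sub, mulVec_add, mulVec_smul, dotProduct_sub, dotProduct_add,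
    dotProduct_smul, smul_eq_mul, hsymm]
  ring
end

section
/- Let A be a real m×m matrix, P a real symmetric positive definite m×m matrix, and Q a real symmetric m×m matrix satisfying the Lyapunov equation AᵀQ + QA = −P. Then the number of distinct complex eigenvalues λ of A with Re λ > 0 is at most the number of negative eigenvalues of Q counted with multiplicity (the index of Q). -/
open Matrix

open Filter Topology

/-- The quadratic form of a solution `Q` of `AᵀQ + QA = −P` is negative at every point `x 0 ≠ 0`
on a trajectory of `x' = Ax` that tends to `0` in backward time. -/
lemma lyapunov_form_neg_of_tendsto_atBot {n : Type*} [Fintype n]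
    {A P Q : Matrix n n ℝ} (hP : P.PosDef) (hLyap : Aᵀ * Q + Q * A = -P)
    {x : ℝ → n → ℝ} (hx : ∀ t, HasDerivAt x (A *ᵥ x t) t)
    (hlim : Tendsto x atBot (𝓝 0)) (h0 : x 0 ≠ 0) :
    x 0 ⬝ᵥ Q *ᵥ x 0 < 0 := by
  have hder : ∀ t, HasDerivAt (fun s => x s ⬝ᵥ Q *ᵥ x s) (-(x t ⬝ᵥ P *ᵥ x t)) t := by
    intro t
    have hcoord := hasDerivAt_pi.1 (hx t)
    have hQx : ∀ i, HasDerivAt (fun s => (Q *ᵥ x s) i) ((Q *ᵥ (A *ᵥ x t)) i) t := fun i =>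
      HasDerivAt.fun_sum fun j _ => (hcoord j).const_mul (Q i j)
    have hsum : HasDerivAt (fun s => x s ⬝ᵥ Q *ᵥ x s)
        ((A *ᵥ x t) ⬝ᵥ Q *ᵥ x t + x t ⬝ᵥ Q *ᵥ (A *ᵥ x t)) t := by
      simp only [dotProduct, ← Finset.sum_add_distrib]
      exact HasDerivAt.fun_sum fun i _ => (hcoord i).mul (hQx i)
    convert hsum using 1
    rw [← dotProduct_neg, ← neg_mulVec, ← hLyap, add_mulVec, dotProduct_add,
      ← mulVec_mulVec, ← mulVec_mulVec, dotProduct_mulVec (x t) Aᵀ, vecMul_transpose]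
  have hpos : ∀ y : n → ℝ, y ≠ 0 → 0 < y ⬝ᵥ P *ᵥ y := fun y hy => by
    simpa using hP.dotProduct_mulVec_pos hy
  have hanti : Antitone fun s => x s ⬝ᵥ Q *ᵥ x s := by
    refine antitone_of_deriv_nonpos (fun t => (hder t).differentiableAt) fun t => ?_
    rw [(hder t).deriv, neg_nonpos]
    rcases eq_or_ne (x t) 0 with h | h
    · simp [h]
    · exact (hpos _ h).le
  have hform : Tendsto (fun s => x s ⬝ᵥ Q *ᵥ x s) atBot (𝓝 0) := by
    have hcont : Continuous fun y : n → ℝ => y ⬝ᵥ Q *ᵥ y := by fun_prop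
    simpa [Function.comp_def] using (hcont.tendsto 0).comp hlim
  have hle : ∀ t, x t ⬝ᵥ Q *ᵥ x t ≤ 0 := fun t => hanti.ge_of_tendsto hform t
  refine lt_of_le_of_ne (hle 0) fun hzero => ?_
  have hmax : IsLocalMax (fun s => x s ⬝ᵥ Q *ᵥ x s) 0 :=
    Eventually.of_forall fun t => (hle t).trans_eq hzero.symm
  have := hmax.hasDerivAt_eq_zero (hder 0)
  linarith [hpos _ h0]

/-- The real part of a linear combination of eigenvectors for eigenvalues in the open right
half-plane lies on a trajectory of `x' = Ax` that tends to `0` in backward time. -/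
lemma exists_trajectory_re_sum_eigenvectors {n ι : Type*} [Fintype n] [Fintype ι]
    (A : Matrix n n ℝ) {μ : ι → ℂ} {v : ι → n → ℂ} (hμ : ∀ j, 0 < (μ j).re)
    (hv : ∀ j, A.map Complex.ofReal *ᵥ v j = μ j • v j) (c : ι → ℂ) :
    ∃ x : ℝ → n → ℝ, (∀ t, HasDerivAt x (A *ᵥ x t) t) ∧ Tendsto x atBot (𝓝 0) ∧
      x 0 = fun i => ((∑ j, c j • v j) i).re := by
  refine ⟨fun t i => (∑ j, c j * Complex.exp (t * μ j) * v j i).re, fun t => ?_, ?_, ?_⟩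
  · refine hasDerivAt_pi.2 fun i => ?_
    have hexp : ∀ j, HasDerivAt (fun s : ℝ => c j * Complex.exp (s * μ j) * v j i)
        (c j * Complex.exp (t * μ j) * (μ j • v j) i) t := fun j => by
      have := ((((Complex.ofRealCLM.hasDerivAt (x := t)).mul_const (μ j)).cexp).const_mul
        (c j)).mul_const (v j i)
      refine this.congr_deriv ?_
      simp only [Pi.smul_apply, smul_eq_mul, Complex.ofRealCLM_apply, Complex.ofReal_one]
      ring
    have hsum := Complex.reCLM.hasFDerivAt.comp_hasDerivAt t
      (HasDerivAt.fun_sum fun j (_ : j ∈ Finset.univ) => hexp j)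
    refine hsum.congr_deriv ?_
    simp only [← hv, mulVec, dotProduct, Complex.reCLM_apply, Complex.re_sum, Finset.mul_sum,
      Matrix.map_apply]
    rw [Finset.sum_comm]
    refine Finset.sum_congr rfl fun j _ => Finset.sum_congr rfl fun k _ => ?_
    rw [mul_left_comm, Complex.re_ofReal_mul]
  · refine tendsto_pi_nhds.2 fun i => ?_
    have hexp : ∀ j, Tendsto (fun t : ℝ => Complex.exp (t * μ j)) atBot (𝓝 0) := fun j => by
      rw [Complex.tendsto_exp_nhds_zero_iff]
      simpa using tendsto_id.atBot_mul_const (hμ j)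
    have hsum : Tendsto (fun t : ℝ => ∑ j, c j * Complex.exp (t * μ j) * v j i) atBot
        (𝓝 (∑ j, c j * 0 * v j i)) :=
      tendsto_finsetSum _ fun j _ => ((hexp j).const_mul (c j)).mul_const (v j i)
    simpa [Function.comp_def] using (Complex.continuous_re.tendsto _).comp hsum
  · ext i
    simp

/-- If a vector is orthogonal to the eigenvectors of `Q` with negative eigenvalue, then the
quadratic form of `Q` is nonnegative at it. -/
lemma Matrix.IsHermitian.form_nonneg_of_orthogonal {n : Type*} [Fintype n] [DecidableEq n]
    {Q : Matrix n n ℝ} (hQ : Q.IsHermitian) {y : n → ℝ}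
    (hy : ∀ i, hQ.eigenvalues i < 0 → ∑ l, hQ.eigenvectorBasis i l * y l = 0) :
    0 ≤ y ⬝ᵥ Q *ᵥ y := by
  set U : Matrix n n ℝ := (hQ.eigenvectorUnitary : Matrix n n ℝ) with hU
  have hspec : Q = U * diagonal hQ.eigenvalues * Uᵀ := by
    simpa [Unitary.conjStarAlgAut_apply, star_eq_conjTranspose, Function.comp_def]
      using hQ.spectral_theorem
  have hform : y ⬝ᵥ Q *ᵥ y = (Uᵀ *ᵥ y) ⬝ᵥ diagonal hQ.eigenvalues *ᵥ (Uᵀ *ᵥ y) := by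
    conv_lhs => rw [hspec]
    rw [← mulVec_mulVec, ← mulVec_mulVec, dotProduct_mulVec, ← mulVec_transpose]
  rw [hform]
  refine Finset.sum_nonneg fun i _ => ?_
  rw [mulVec_diagonal, mul_left_comm]
  rcases lt_or_ge (hQ.eigenvalues i) 0 with h | h
  · have hzero : (Uᵀ *ᵥ y) i = 0 := by
      simpa [mulVec, dotProduct, hU, IsHermitian.eigenvectorUnitary_apply] using hy i h
    simp [hzero]
  · exact mul_nonneg h (mul_self_nonneg _)

/-- **Corollary 5.2 of the paper.** If `Q` is a symmetric solution of the Lyapunov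
equation `AᵀQ + QA = −P` with `P` symmetric positive definite, then the number of
distinct eigenvalues of `A` in the strict right half plane is at most the index of `Q`
(the number of negative eigenvalues of `Q` counted with multiplicity). -/
theorem lyapunov_equation_index_bound
    (m : ℕ) (A P Q : Matrix (Fin m) (Fin m) ℝ)
    (hP : P.PosDef) (hQ : Q.IsHermitian)
    (hLyap : Aᵀ * Q + Q * A = -P) :
    ((A.map Complex.ofReal).charpoly.roots.toFinset.filter
        (fun z => 0 < z.re)).card ≤
      (Finset.univ.filter (fun i => hQ.eigenvalues i < 0)).card := by
  set S := (A.map Complex.ofReal).charpoly.roots.toFinset.filter (fun z => 0 < z.re)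
  set N := Finset.univ.filter (fun i => hQ.eigenvalues i < 0) with hN
  have hre : ∀ z : S, 0 < (z : ℂ).re := fun z => (Finset.mem_filter.1 z.2).2
  have heig : ∀ z : S, ∃ v,
      Module.End.HasEigenvector (toLin' (A.map Complex.ofReal)) (z : ℂ) v := by
    intro z
    have hroot := Polynomial.isRoot_of_mem_roots
      (Multiset.mem_toFinset.1 (Finset.mem_filter.1 z.2).1)
    rw [← Matrix.charpoly_toLin', ← Module.End.hasEigenvalue_iff_isRoot_charpoly] at hroot
    exact hroot.exists_hasEigenvector
  choose v hv using heig
  have hind : LinearIndependent ℂ v :=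
    Module.End.eigenvectors_linearIndependent' _ _ Subtype.val_injective _ hv
  have hre_zero : ∀ c : S → ℂ,
      (∀ i, hQ.eigenvalues i < 0 →
        ∑ l, (hQ.eigenvectorBasis i l : ℂ) * (∑ z, c z • v z) l = 0) →
      ∀ l, ((∑ z, c z • v z) l).re = 0 := by
    intro c hc
    obtain ⟨x, hx, hlim, hx0⟩ := exists_trajectory_re_sum_eigenvectors A hre
      (fun z => by simpa using (hv z).apply_eq_smul) c
    have hnonneg : 0 ≤ x 0 ⬝ᵥ Q *ᵥ x 0 := by
      refine hQ.form_nonneg_of_orthogonal fun i hi => ?_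
      simpa only [hx0, Complex.re_sum, Complex.re_ofReal_mul, Complex.zero_re]
        using congrArg Complex.re (hc i hi)
    by_contra! ⟨l, hl⟩
    refine hnonneg.not_gt (lyapunov_form_neg_of_tendsto_atBot hP hLyap hx hlim fun h => hl ?_)
    rw [hx0] at h
    exact congrFun h l
  let f : (S → ℂ) →ₗ[ℂ] (N → ℂ) :=
    (Matrix.of fun (i : N) l => (hQ.eigenvectorBasis i l : ℂ)).mulVecLin ∘ₗ
      Fintype.linearCombination ℂ v
  have hf : Function.Injective f := by
    refine (injective_iff_map_eq_zero f).2 fun c hc => ?_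
    have horth : ∀ i, hQ.eigenvalues i < 0 →
        ∑ l, (hQ.eigenvectorBasis i l : ℂ) * (∑ z, c z • v z) l = 0 := fun i hi =>
      congrFun hc ⟨i, by simpa [hN] using hi⟩
    have him : ∀ l, ((∑ z, (-Complex.I * c z) • v z) l).re = 0 := by
      refine hre_zero _ fun i hi => ?_
      simp only [mul_smul, ← Finset.smul_sum, Pi.smul_apply (-Complex.I), smul_eq_mul,
        mul_left_comm _ (-Complex.I), ← Finset.mul_sum, horth i hi, mul_zero]
    have hzero : ∑ z, c z • v z = 0 := by
      ext l
      refine Complex.ext (hre_zero c horth l) ?_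
      have := him l
      simp only [mul_smul, ← Finset.smul_sum, Pi.smul_apply (-Complex.I), smul_eq_mul] at this
      simpa using this
    exact funext (Fintype.linearIndependent_iff.1 hind c hzero)
  simpa using LinearMap.finrank_le_finrank_of_injective hf
end

section
/- Let Ω be a real invertible skew-symmetric 2n×2n matrix, Q a real symmetric 2n×2n matrix, and B a real 2n×2n matrix, and for ε ∈ ℝ set A_ε = (Ωᵀ)⁻¹Q + εB. Suppose λ : ℝ → ℂ is differentiable at 0, ξ : ℝ → ℂ²ⁿ is continuous at 0, A_ε ξ(ε) = λ(ε) ξ(ε) for all ε in a neighborhood of 0, and write ξ(0) = x_r + i x_i with x_r, x_i ∈ ℝ²ⁿ. Define E(x) = ½ xᵀQx and Ė′(x) = xᵀQBx, and assume E(x_r) + E(x_i) ≠ 0. Then Re λ(0) = 0 and the derivative of ε ↦ Re λ(ε) at ε = 0 equals ½ (Ė′(x_r) + Ė′(x_i)) / (E(x_r) + E(x_i)). -/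
open Matrix

/-- The congruence of the inverse of an invertible skew-symmetric matrix by a symmetric one is
isotropic: `xᵀ Q (Ωᵀ)⁻¹ Q x = 0`. -/
theorem dotProduct_symm_mul_skew_inv_mul_symm_mulVec {m : Type*} [Fintype m] [DecidableEq m]
    {Ω Q : Matrix m m ℝ} (hΩ : Ωᵀ = -Ω) (hΩinv : IsUnit Ω.det)
    (hQ : Qᵀ = Q) (x : m → ℝ) :
    x ⬝ᵥ (Q * ((Ωᵀ)⁻¹ * Q)) *ᵥ x = 0 := by
  have hinv : (-Ω)⁻¹ = -Ω⁻¹ :=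
    inv_eq_left_inv (by rw [neg_mul_neg, nonsing_inv_mul _ hΩinv])
  have hT : (Q * ((Ωᵀ)⁻¹ * Q))ᵀ = -(Q * ((Ωᵀ)⁻¹ * Q)) := by
    rw [transpose_mul, transpose_mul, hQ, transpose_nonsing_inv, transpose_transpose, hΩ, hinv]
    simp [Matrix.mul_assoc]
  have h : x ⬝ᵥ (Q * ((Ωᵀ)⁻¹ * Q)) *ᵥ x = -(x ⬝ᵥ (Q * ((Ωᵀ)⁻¹ * Q)) *ᵥ x) := by
    conv_lhs => rw [dotProduct_mulVec, ← mulVec_transpose, hT, dotProduct_comm]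
    simp [neg_mulVec]
  linarith

/-- For a complex eigenpair of a real matrix `A` and a real symmetric form `Q`, the real part of
the eigenvalue is governed by the form `Q * A` on the real and imaginary parts. -/
theorem re_eigenvalue_mul_form {m : Type*} [Fintype m]
    {A Q : Matrix m m ℝ} (hQ : Qᵀ = Q) {μ : ℂ} {z : m → ℂ}
    (h : (A.map Complex.ofReal) *ᵥ z = μ • z) :
    μ.re * ((fun j => (z j).re) ⬝ᵥ Q *ᵥ (fun j => (z j).re)
        + (fun j => (z j).im) ⬝ᵥ Q *ᵥ (fun j => (z j).im))
      = (fun j => (z j).re) ⬝ᵥ (Q * A) *ᵥ (fun j => (z j).re)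
        + (fun j => (z j).im) ⬝ᵥ (Q * A) *ᵥ (fun j => (z j).im) := by
  set u : m → ℝ := fun j => (z j).re with hu
  set v : m → ℝ := fun j => (z j).im with hv
  have h1 : A *ᵥ u = μ.re • u - μ.im • v := by
    ext i
    have := congrArg Complex.re (congrFun h i)
    simpa [mulVec, dotProduct, hu, hv] using this
  have h2 : A *ᵥ v = μ.re • v + μ.im • u := by
    ext i
    have := congrArg Complex.im (congrFun h i)
    simpa [mulVec, dotProduct, hu, hv] using this
  have h3 : u ⬝ᵥ Q *ᵥ v = v ⬝ᵥ Q *ᵥ u := by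
    rw [dotProduct_mulVec, ← mulVec_transpose, hQ, dotProduct_comm]
  rw [← mulVec_mulVec, ← mulVec_mulVec, h1, h2]
  simp only [mulVec_add, mulVec_sub, mulVec_smul, dotProduct_add, dotProduct_sub,
    dotProduct_smul, smul_eq_mul, h3]
  ring

/-- If `a ε * q ε = ε * r ε` near `0` with `q`, `r` continuous at `0` and `q 0 ≠ 0`, then `a` has
derivative `r 0 / q 0` at `0`. -/
theorem hasDerivAt_zero_of_mul_eq_mul {a q r : ℝ → ℝ} (hq : ContinuousAt q 0)
    (hr : ContinuousAt r 0) (hq0 : q 0 ≠ 0) (h : ∀ᶠ ε in nhds (0 : ℝ), a ε * q ε = ε * r ε) :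
    HasDerivAt a (r 0 / q 0) 0 := by
  have ha0 : a 0 = 0 := by simpa [hq0] using h.self_of_nhds
  rw [hasDerivAt_iff_tendsto_slope]
  refine ((hr.div hq hq0).tendsto.mono_left nhdsWithin_le_nhds).congr' ?_
  filter_upwards [nhdsWithin_le_nhds h, nhdsWithin_le_nhds (hq.eventually_ne hq0),
    self_mem_nhdsWithin] with ε h1 h2 h3
  have h3' : ε ≠ 0 := h3
  simp only [slope_def_field, ha0, sub_zero, Pi.div_apply]
  rw [div_eq_div_iff h2 h3']
  linarith

/-- **Corollary 5.3 of the paper.** For the dissipatively perturbed linear Hamiltonian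
system `A_ε = (Ωᵀ)⁻¹Q + εB`, an eigenvalue–eigenvector branch `(λ(ε), ξ(ε))` with
`ξ(0) = x_r + i x_i` and `E(x_r) + E(x_i) ≠ 0`, where `E(x) = ½ xᵀQx`, satisfies
`Re λ(0) = 0` and `(d/dε)|₀ Re λ(ε) = ½ (Ė′(x_r) + Ė′(x_i)) / (E(x_r) + E(x_i))`,
where `Ė′(x) = xᵀQBx`. -/
theorem eigenvalue_crossing_derivative
    (n : ℕ) (Ω Q B : Matrix (Fin (2 * n)) (Fin (2 * n)) ℝ)
    (hΩ : Ωᵀ = -Ω) (hΩinv : IsUnit Ω.det) (hQ : Qᵀ = Q)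
    (lam : ℝ → ℂ) (ξ : ℝ → Fin (2 * n) → ℂ)
    (hlam : DifferentiableAt ℝ lam 0) (hξ : ContinuousAt ξ 0)
    (heig : ∀ᶠ ε in nhds (0 : ℝ),
      (((Ωᵀ)⁻¹ * Q + ε • B).map Complex.ofReal).mulVec (ξ ε) = lam ε • ξ ε)
    (xr xi : Fin (2 * n) → ℝ)
    (hx : ξ 0 = fun j => (xr j : ℂ) + (xi j : ℂ) * Complex.I)
    (hden : (1 / 2) * (xr ⬝ᵥ Q.mulVec xr) + (1 / 2) * (xi ⬝ᵥ Q.mulVec xi) ≠ 0) :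
    (lam 0).re = 0 ∧
    deriv (fun ε => (lam ε).re) 0 =
      (1 / 2) * (xr ⬝ᵥ (Q * B).mulVec xr + xi ⬝ᵥ (Q * B).mulVec xi)
        / ((1 / 2) * (xr ⬝ᵥ Q.mulVec xr) + (1 / 2) * (xi ⬝ᵥ Q.mulVec xi)) := by
  have hre : ContinuousAt (fun ε j => (ξ ε j).re) 0 :=
    continuousAt_pi.2 fun j => Complex.continuous_re.continuousAt.comp (continuousAt_pi.1 hξ j)
  have him : ContinuousAt (fun ε j => (ξ ε j).im) 0 :=
    continuousAt_pi.2 fun j => Complex.continuous_im.continuousAt.comp (continuousAt_pi.1 hξ j)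
  have hform (M : Matrix (Fin (2 * n)) (Fin (2 * n)) ℝ) :
      ContinuousAt (fun ε => (fun j => (ξ ε j).re) ⬝ᵥ M *ᵥ (fun j => (ξ ε j).re)
        + (fun j => (ξ ε j).im) ⬝ᵥ M *ᵥ (fun j => (ξ ε j).im)) 0 := by
    have hM : Continuous fun x : Fin (2 * n) → ℝ => x ⬝ᵥ M *ᵥ x := by fun_prop
    exact (hM.continuousAt.comp hre).add (hM.continuousAt.comp him)
  have hr0 : (fun j => (ξ 0 j).re) = xr := by ext j; simp [hx]
  have hi0 : (fun j => (ξ 0 j).im) = xi := by ext j; simp [hx]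
  have hq0 : xr ⬝ᵥ Q *ᵥ xr + xi ⬝ᵥ Q *ᵥ xi ≠ 0 := by
    rwa [← mul_add, mul_ne_zero_iff_left (by norm_num)] at hden
  have hbal : ∀ᶠ ε in nhds (0 : ℝ),
      (lam ε).re * ((fun j => (ξ ε j).re) ⬝ᵥ Q *ᵥ (fun j => (ξ ε j).re)
        + (fun j => (ξ ε j).im) ⬝ᵥ Q *ᵥ (fun j => (ξ ε j).im))
      = ε * ((fun j => (ξ ε j).re) ⬝ᵥ (Q * B) *ᵥ (fun j => (ξ ε j).re)
        + (fun j => (ξ ε j).im) ⬝ᵥ (Q * B) *ᵥ (fun j => (ξ ε j).im)) := by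
    filter_upwards [heig] with ε hε
    rw [re_eigenvalue_mul_form hQ hε]
    simp only [Matrix.mul_add, add_mulVec, dotProduct_add, Matrix.mul_smul, smul_mulVec,
      dotProduct_smul, smul_eq_mul, dotProduct_symm_mul_skew_inv_mul_symm_mulVec hΩ hΩinv hQ]
    ring
  have hderiv := hasDerivAt_zero_of_mul_eq_mul (a := fun ε => (lam ε).re) (hform Q)
    (hform (Q * B)) (by simpa only [hr0, hi0] using hq0) hbal
  simp only [hr0, hi0] at hderiv
  refine ⟨?_, ?_⟩
  · have h0 := hbal.self_of_nhds
    simp only [hr0, hi0, zero_mul] at h0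
    exact (mul_eq_zero.1 h0).resolve_right hq0
  · rw [hderiv.deriv, ← mul_add, mul_div_mul_left _ _ (by norm_num)]
end

section
/- (Crossing-speed formula) Let Ω be a real invertible skew-symmetric 2n×2n matrix, Q a real symmetric 2n×2n matrix, and B a real 2n×2n matrix, and for ε ∈ ℝ set A_ε = (Ωᵀ)⁻¹Q + εB. Suppose λ : ℝ → ℂ is differentiable at 0, ξ : ℝ → ℂ²ⁿ is continuous at 0, A_ε ξ(ε) = λ(ε) ξ(ε) for all ε in a neighborhood of 0, ξ(0) = ξ₀ ≠ 0, λ(0) = iω with ω a nonzero real number, and ξ₀* Ω ξ₀ ≠ 0, where ξ₀* denotes the conjugate transpose. Then, as complex numbers, the derivative of ε ↦ Re λ(ε) at ε = 0 equals (ξ₀* (ΩB − (ΩB)ᵀ) ξ₀) / (2 ξ₀* Ω ξ₀); in particular this quotient is real. -/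
open Matrix

open Filter Topology

namespace CrossingSpeed

variable {m : Type*} [Fintype m]

/-- The sesquilinear form `x* M y` on complex vectors attached to a real matrix `M`. -/
noncomputable def form (M : Matrix m m ℝ) (x y : m → ℂ) : ℂ :=
  star x ⬝ᵥ (M.map Complex.ofReal).mulVec y

theorem form_add (M N : Matrix m m ℝ) (x y : m → ℂ) :
    form (M + N) x y = form M x y + form N x y := by
  simp [form, Matrix.map_add, add_mulVec, dotProduct_add]

theorem form_neg (M : Matrix m m ℝ) (x y : m → ℂ) : form (-M) x y = -form M x y := by
  have h : (-M).map Complex.ofReal = -M.map Complex.ofReal := by ext; simp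
  simp [form, h, neg_mulVec]

theorem form_sub (M N : Matrix m m ℝ) (x y : m → ℂ) :
    form (M - N) x y = form M x y - form N x y := by
  rw [sub_eq_add_neg, form_add, form_neg, sub_eq_add_neg]

theorem form_smul (c : ℝ) (M : Matrix m m ℝ) (x y : m → ℂ) :
    form (c • M) x y = c * form M x y := by
  have h : (c • M).map Complex.ofReal = (c : ℂ) • M.map Complex.ofReal := by ext; simp
  simp [form, h, smul_mulVec]

theorem form_smul_right (M : Matrix m m ℝ) (x y : m → ℂ) (c : ℂ) :
    form M x (c • y) = c * form M x y := by
  simp [form, mulVec_smul]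

theorem form_mul (M N : Matrix m m ℝ) (x y : m → ℂ) :
    form (M * N) x y = form M x ((N.map Complex.ofReal).mulVec y) := by
  have h : (M * N).map Complex.ofReal = M.map Complex.ofReal * N.map Complex.ofReal :=
    Matrix.map_mul (f := Complex.ofRealHom)
  rw [form, form, h, mulVec_mulVec]

theorem star_form (M : Matrix m m ℝ) (x y : m → ℂ) : star (form M x y) = form Mᵀ y x := by
  have h : (M.map Complex.ofReal)ᴴ = Mᵀ.map Complex.ofReal := by ext; simp
  rw [form, form, ← star_dotProduct_star, star_star, star_mulVec, h, dotProduct_mulVec]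

theorem continuous_form (M : Matrix m m ℝ) (x : m → ℂ) : Continuous (form M x) := by
  unfold form
  fun_prop

variable [DecidableEq m]

/-- Multiplying the Hamiltonian matrix by its symplectic matrix recovers the energy. -/
theorem mul_transpose_inv_mul {Ω : Matrix m m ℝ} (hΩ : Ωᵀ = -Ω) (hΩinv : IsUnit Ω.det)
    (Q : Matrix m m ℝ) : Ω * ((Ωᵀ)⁻¹ * Q) = -Q := by
  have h : IsUnit Ωᵀ.det := by rwa [det_transpose]
  rw [← neg_eq_iff_eq_neg, ← Matrix.neg_mul, ← hΩ, mul_nonsing_inv_cancel_left _ _ h]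

/-- An eigenvector for a purely imaginary eigenvalue of a Hamiltonian matrix is also a left
eigenvector, after pairing with the symplectic form. -/
theorem form_energy_left {Ω Q : Matrix m m ℝ} (hΩ : Ωᵀ = -Ω) (hΩinv : IsUnit Ω.det)
    (hQ : Qᵀ = Q) {x : m → ℂ} {ω : ℝ}
    (hx : (((Ωᵀ)⁻¹ * Q).map Complex.ofReal).mulVec x = (Complex.I * (ω : ℂ)) • x) (y : m → ℂ) :
    form Q x y = -(Complex.I * ω) * form Ω x y := by
  have h : form Q y x = -(Complex.I * ω) * form Ω y x := by
    rw [← neg_neg Q, form_neg, ← mul_transpose_inv_mul hΩ hΩinv Q, form_mul, hx,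
      form_smul_right, neg_mul]
  have h' := congrArg star h
  rw [star_mul', star_form, star_form, hQ, hΩ, form_neg] at h'
  simpa using h'

/-- First-order perturbation of a purely imaginary eigenvalue of a Hamiltonian matrix. -/
theorem deriv_mul_form {Ω Q B : Matrix m m ℝ} (hΩ : Ωᵀ = -Ω) (hΩinv : IsUnit Ω.det)
    (hQ : Qᵀ = Q) {lam : ℝ → ℂ} {ξ : ℝ → m → ℂ}
    (hlam : DifferentiableAt ℝ lam 0) (hξ : ContinuousAt ξ 0)
    (heig : ∀ᶠ ε in 𝓝 (0 : ℝ),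
      (((Ωᵀ)⁻¹ * Q + ε • B).map Complex.ofReal).mulVec (ξ ε) = lam ε • ξ ε)
    {ω : ℝ} (hlam0 : lam 0 = Complex.I * (ω : ℂ)) :
    deriv lam 0 * form Ω (ξ 0) (ξ 0) = form (Ω * B) (ξ 0) (ξ 0) := by
  have hx : (((Ωᵀ)⁻¹ * Q).map Complex.ofReal).mulVec (ξ 0) = (Complex.I * (ω : ℂ)) • ξ 0 := by
    simpa [hlam0] using heig.self_of_nhds
  have hform (M : Matrix m m ℝ) :
      Tendsto (fun ε => form M (ξ 0) (ξ ε)) (𝓝[≠] 0) (𝓝 (form M (ξ 0) (ξ 0))) :=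
    (((continuous_form M (ξ 0)).tendsto _).comp hξ).mono_left nhdsWithin_le_nhds
  refine tendsto_nhds_unique (hlam.hasDerivAt.tendsto_slope.mul (hform Ω))
    ((hform (Ω * B)).congr' ?_)
  filter_upwards [heig.filter_mono nhdsWithin_le_nhds, self_mem_nhdsWithin] with ε hε hne
  have hne' : (ε : ℂ) ≠ 0 := Complex.ofReal_ne_zero.mpr hne
  have h := congrArg (form Ω (ξ 0)) hε
  rw [← form_mul, Matrix.mul_add, mul_transpose_inv_mul hΩ hΩinv, Matrix.mul_smul, form_add,
    form_neg, form_smul, form_smul_right, form_energy_left hΩ hΩinv hQ hx] at h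
  rw [slope_def_module, hlam0, sub_zero, Complex.real_smul, Complex.ofReal_inv]
  field_simp
  linear_combination h

end CrossingSpeed

open CrossingSpeed

/-- **Crossing-speed formula** (Lemma 5.4 / formula (5.11) of the paper, MacKay's
formula). For a dissipatively perturbed linear Hamiltonian system `A_ε = (Ωᵀ)⁻¹Q + εB`
with an eigenvalue branch `λ(ε)` emanating from a nonzero purely imaginary eigenvalue
`iω` with eigenvector `ξ₀` satisfying `ξ₀*Ωξ₀ ≠ 0`, the crossing speed is
`(d/dε)|₀ Re λ(ε) = ξ₀*(ΩB − (ΩB)ᵀ)ξ₀ / (2 ξ₀*Ωξ₀)`. -/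
theorem crossing_speed_formula
    (n : ℕ) (Ω Q B : Matrix (Fin (2 * n)) (Fin (2 * n)) ℝ)
    (hΩ : Ωᵀ = -Ω) (hΩinv : IsUnit Ω.det) (hQ : Qᵀ = Q)
    (lam : ℝ → ℂ) (ξ : ℝ → Fin (2 * n) → ℂ)
    (hlam : DifferentiableAt ℝ lam 0) (hξcont : ContinuousAt ξ 0)
    (heig : ∀ᶠ ε in nhds (0 : ℝ),
      (((Ωᵀ)⁻¹ * Q + ε • B).map Complex.ofReal).mulVec (ξ ε) = lam ε • ξ ε)
    (hξ0 : ξ 0 ≠ 0) (ω : ℝ) (hω : ω ≠ 0) (hlam0 : lam 0 = Complex.I * (ω : ℂ))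
    (hpair : star (ξ 0) ⬝ᵥ (Ω.map Complex.ofReal).mulVec (ξ 0) ≠ 0) :
    ((deriv (fun ε => (lam ε).re) 0 : ℝ) : ℂ) =
      (star (ξ 0) ⬝ᵥ ((Ω * B - (Ω * B)ᵀ).map Complex.ofReal).mulVec (ξ 0))
        / (2 * (star (ξ 0) ⬝ᵥ (Ω.map Complex.ofReal).mulVec (ξ 0))) := by
  change _ = form (Ω * B - (Ω * B)ᵀ) (ξ 0) (ξ 0) / (2 * form Ω (ξ 0) (ξ 0))
  change form Ω (ξ 0) (ξ 0) ≠ 0 at hpair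
  have hd : deriv lam 0 * form Ω (ξ 0) (ξ 0) = form (Ω * B) (ξ 0) (ξ 0) :=
    deriv_mul_form hΩ hΩinv hQ hlam hξcont heig hlam0
  have hre : deriv (fun ε => (lam ε).re) 0 = (deriv lam 0).re :=
    (Complex.reCLM.hasFDerivAt.comp_hasDerivAt 0 hlam.hasDerivAt).deriv
  have hd' := congrArg star hd
  rw [star_mul', star_form, star_form, hΩ, form_neg] at hd'
  rw [hre, Complex.re_eq_add_conj, form_sub, ← hd, ← hd', starRingEnd_apply]
  field_simp
  ring
end

section
/- (Averaging formula) Let Ω be a real invertible skew-symmetric 2n×2n matrix, Q a real symmetric 2n×2n matrix, and B a real 2n×2n matrix, and set A = (Ωᵀ)⁻¹Q. Suppose ξ ∈ ℂ²ⁿ satisfies Aξ = iωξ with ω > 0 real, and let x_r(t) = Re(e^{iωt} ξ) ∈ ℝ²ⁿ. Then the average of Ė′(x_r(t)) = x_r(t)ᵀ Q B x_r(t) over one period, (ω / 2π) ∫₀^{2π/ω} x_r(t)ᵀ Q B x_r(t) dt, equals (as a complex number) −(iω/4) · ξ* (ΩB − (ΩB)ᵀ) ξ, where ξ* denotes the conjugate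 transpose. -/
open Matrix

section RealImaginaryParts

variable {m : Type*} [Fintype m]

theorem Matrix.re_map_ofReal_mulVec (M : Matrix m m ℝ) (v : m → ℂ) (j : m) :
    ((M.map Complex.ofReal).mulVec v j).re = M.mulVec (fun k => (v k).re) j := by
  simp [Matrix.mulVec, dotProduct]

theorem Matrix.im_map_ofReal_mulVec (M : Matrix m m ℝ) (v : m → ℂ) (j : m) :
    ((M.map Complex.ofReal).mulVec v j).im = M.mulVec (fun k => (v k).im) j := by
  simp [Matrix.mulVec, dotProduct]

theorem Matrix.star_dotProduct_map_ofReal_mulVec (M : Matrix m m ℝ) (v : m → ℂ) :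
    star v ⬝ᵥ (M.map Complex.ofReal).mulVec v =
      (((fun k => (v k).re) ⬝ᵥ M.mulVec (fun k => (v k).re) +
        (fun k => (v k).im) ⬝ᵥ M.mulVec (fun k => (v k).im) : ℝ) : ℂ) +
      (((fun k => (v k).re) ⬝ᵥ M.mulVec (fun k => (v k).im) -
        (fun k => (v k).im) ⬝ᵥ M.mulVec (fun k => (v k).re) : ℝ) : ℂ) * Complex.I := by
  apply Complex.ext <;>
  simp only [dotProduct, Complex.re_sum, Complex.im_sum, Complex.mul_re, Complex.mul_im,
    re_map_ofReal_mulVec, im_map_ofReal_mulVec, Pi.star_apply, RCLike.star_def,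
    Complex.conj_re, Complex.conj_im, Complex.add_re, Complex.add_im, Complex.ofReal_re,
    Complex.ofReal_im, Complex.I_re, Complex.I_im, ← Finset.sum_add_distrib,
    ← Finset.sum_sub_distrib, mul_zero, mul_one, sub_zero, add_zero, zero_add] <;>
  exact Finset.sum_congr rfl fun _ _ => by ring

theorem Matrix.dotProduct_transpose_mulVec_comm (M : Matrix m m ℝ) (u v : m → ℝ) :
    u ⬝ᵥ Mᵀ.mulVec v = v ⬝ᵥ M.mulVec u := by
  rw [mulVec_transpose, dotProduct_comm, ← dotProduct_mulVec]

end RealImaginaryParts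

theorem integral_trig_quadratic_period (ω : ℝ) (hω : 0 < ω) (p q r : ℝ) :
    ∫ t in (0 : ℝ)..(2 * Real.pi / ω),
      (p * Real.cos (ω * t) ^ 2 + q * Real.sin (ω * t) ^ 2 -
        r * (Real.sin (ω * t) * Real.cos (ω * t))) = Real.pi / ω * (p + q) := by
  rw [intervalIntegral.integral_comp_mul_left
    (fun s => p * Real.cos s ^ 2 + q * Real.sin s ^ 2 - r * (Real.sin s * Real.cos s)) hω.ne',
    mul_zero, mul_div_cancel₀ _ hω.ne',
    intervalIntegral.integral_sub, intervalIntegral.integral_add]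
  · simp only [intervalIntegral.integral_const_mul, integral_cos_sq, integral_sin_sq,
      integral_sin_mul_cos₁]
    simp
    field_simp
  all_goals exact Continuous.intervalIntegrable (by fun_prop) _ _

/-- **Averaging formula** (formulae (5.16)–(5.17) of the paper). Let `A = (Ωᵀ)⁻¹Q` and
let `ξ` satisfy `Aξ = iωξ` with `ω > 0`. Then the average over one period of the first
order energy dissipation rate `Ė′(x_r(t)) = x_r(t)ᵀQBx_r(t)` along the periodic solution
`x_r(t) = Re(e^{iωt}ξ)` equals `−(iω/4)·ξ*(ΩB − (ΩB)ᵀ)ξ`. -/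
theorem averaged_dissipation_formula
    (n : ℕ) (Ω Q B : Matrix (Fin (2 * n)) (Fin (2 * n)) ℝ)
    (hΩ : Ωᵀ = -Ω) (hΩinv : IsUnit Ω.det) (hQ : Qᵀ = Q)
    (ξ : Fin (2 * n) → ℂ) (ω : ℝ) (hω : 0 < ω)
    (heig : (((Ωᵀ)⁻¹ * Q).map Complex.ofReal).mulVec ξ = (Complex.I * (ω : ℂ)) • ξ) :
    (((ω / (2 * Real.pi)) * ∫ t in (0 : ℝ)..(2 * Real.pi / ω),
        (fun j => (Complex.exp (Complex.I * (ω : ℂ) * (t : ℂ)) * ξ j).re) ⬝ᵥ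
          (Q * B).mulVec
            (fun j => (Complex.exp (Complex.I * (ω : ℂ) * (t : ℂ)) * ξ j).re) : ℝ) : ℂ) =
      -(Complex.I * (ω : ℂ) / 4) *
        (star ξ ⬝ᵥ ((Ω * B - (Ω * B)ᵀ).map Complex.ofReal).mulVec ξ) := by
  set a : Fin (2 * n) → ℝ := fun k => (ξ k).re with ha
  set b : Fin (2 * n) → ℝ := fun k => (ξ k).im with hb
  have hdet : IsUnit (Ωᵀ).det := by rwa [det_transpose]
  have hA : ∀ v, Ωᵀ *ᵥ (((Ωᵀ)⁻¹ * Q) *ᵥ v) = Q *ᵥ v := fun v => by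
    rw [mulVec_mulVec, mul_nonsing_inv_cancel_left _ _ hdet]
  have hAa : ((Ωᵀ)⁻¹ * Q) *ᵥ a = -(ω • b) := by
    funext j
    rw [ha, ← re_map_ofReal_mulVec, heig]
    simp [hb]
  have hAb : ((Ωᵀ)⁻¹ * Q) *ᵥ b = ω • a := by
    funext j
    rw [hb, ← im_map_ofReal_mulVec, heig]
    simp [ha]
  have hQa : Q *ᵥ a = ω • Ω *ᵥ b := by
    rw [← hA, hAa, hΩ, mulVec_neg, neg_mulVec, neg_neg, mulVec_smul]
  have hQb : Q *ᵥ b = -(ω • Ω *ᵥ a) := by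
    rw [← hA, hAb, hΩ, neg_mulVec, mulVec_smul]
  have hQswap : ∀ u v : Fin (2 * n) → ℝ, u ⬝ᵥ (Q * B) *ᵥ v = B *ᵥ v ⬝ᵥ Q *ᵥ u :=
    fun u v => by
      rw [← mulVec_mulVec, ← dotProduct_transpose_mulVec_comm, hQ]
  have hΩswap : ∀ u v : Fin (2 * n) → ℝ, u ⬝ᵥ (Ω * B) *ᵥ v = -(B *ᵥ v ⬝ᵥ Ω *ᵥ u) :=
    fun u v => by
      rw [← mulVec_mulVec, ← dotProduct_transpose_mulVec_comm, hΩ, neg_mulVec,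
        dotProduct_neg]
  have hx : ∀ t : ℝ, (fun j => (Complex.exp (Complex.I * (ω : ℂ) * (t : ℂ)) * ξ j).re) =
      Real.cos (ω * t) • a - Real.sin (ω * t) • b := fun t => by
    funext j
    have he : Complex.I * (ω : ℂ) * (t : ℂ) = ((ω * t : ℝ) : ℂ) * Complex.I := by
      push_cast; ring
    rw [he, Complex.mul_re, Complex.exp_ofReal_mul_I_re, Complex.exp_ofReal_mul_I_im]
    simp [ha, hb]
  have hquad : ∀ t : ℝ,
      (Real.cos (ω * t) • a - Real.sin (ω * t) • b) ⬝ᵥ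
        (Q * B) *ᵥ (Real.cos (ω * t) • a - Real.sin (ω * t) • b) =
      (a ⬝ᵥ (Q * B) *ᵥ a) * Real.cos (ω * t) ^ 2 + (b ⬝ᵥ (Q * B) *ᵥ b) * Real.sin (ω * t) ^ 2 -
        (a ⬝ᵥ (Q * B) *ᵥ b + b ⬝ᵥ (Q * B) *ᵥ a) * (Real.sin (ω * t) * Real.cos (ω * t)) :=
    fun t => by
      simp only [mulVec_sub, mulVec_smul, sub_dotProduct, dotProduct_sub, smul_dotProduct,
        dotProduct_smul, smul_eq_mul]
      ring
  simp only [hx, hquad]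
  rw [integral_trig_quadratic_period ω hω, star_dotProduct_map_ofReal_mulVec]
  simp only [← ha, ← hb, sub_mulVec, dotProduct_sub, dotProduct_transpose_mulVec_comm]
  simp only [hQswap, hΩswap, hQa, hQb, dotProduct_neg, dotProduct_smul, smul_eq_mul]
  have hω' : (ω : ℂ) ≠ 0 := by exact_mod_cast hω.ne'
  have hπ : (Real.pi : ℂ) ≠ 0 := by exact_mod_cast Real.pi_ne_zero
  push_cast
  field_simp
  ring_nf
  simp only [Complex.I_sq]
  ring
end

section
/- (Rigid body with two internal rotors) Let B₁ > B₂ > B₃ be real numbers, J₁¹ > 0, J₂² > 0 with A₁ := B₁ − J₁¹ > 0 and A₂ := B₂ − J₂² > 0, let ω ≠ 0 be real, and let R₁ > 0, R₂ > 0. Then the 4×4 real matrix [[−R₁, −J₂²ω/A₁, 0, (B₃ − B₂)ω/A₁], [J₁¹ω/A₂, −R₂, (B₁ − B₃)ω/A₂, 0], [0, J₂²ω/A₁, 0, (B₂ − B₃)ω/A₁], [−J₁¹ω/A₂, 0, (B₃ − B₁)ω/A₂, 0]] has a complex eigenvalue with strictly positive real part. -/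
open Matrix

theorem exists_root_cubic (e f g : ℂ) : ∃ z : ℂ, z ^ 3 + e * z ^ 2 + f * z + g = 0 := by
  have hdeg : (Cubic.toPoly ⟨1, e, f, g⟩ : Polynomial ℂ).degree = 3 :=
    Cubic.degree_of_a_ne_zero one_ne_zero
  obtain ⟨z, hz⟩ := IsAlgClosed.exists_root (Cubic.toPoly ⟨1, e, f, g⟩ : Polynomial ℂ)
    (by rw [hdeg]; norm_num)
  exact ⟨z, by simpa [Cubic.toPoly, Polynomial.IsRoot] using hz⟩

theorem exists_root_quadratic (a b : ℂ) : ∃ z : ℂ, z ^ 2 + a * z + b = 0 := by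
  have hdeg : (Cubic.toPoly ⟨0, 1, a, b⟩ : Polynomial ℂ).degree = 2 :=
    Cubic.degree_of_b_ne_zero rfl one_ne_zero
  obtain ⟨z, hz⟩ := IsAlgClosed.exists_root (Cubic.toPoly ⟨0, 1, a, b⟩ : Polynomial ℂ)
    (by rw [hdeg]; norm_num)
  exact ⟨z, by simpa [Cubic.toPoly, Polynomial.IsRoot] using hz⟩

theorem exists_root_quartic (a₃ a₂ a₁ a₀ : ℂ) :
    ∃ z : ℂ, z ^ 4 + a₃ * z ^ 3 + a₂ * z ^ 2 + a₁ * z + a₀ = 0 := by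
  have hdeg : (Polynomial.X * Cubic.toPoly ⟨1, a₃, a₂, a₁⟩ + Polynomial.C a₀ :
      Polynomial ℂ).degree = 4 := by
    simp only [Cubic.toPoly]
    compute_degree!
  obtain ⟨z, hz⟩ := IsAlgClosed.exists_root
    (Polynomial.X * Cubic.toPoly ⟨1, a₃, a₂, a₁⟩ + Polynomial.C a₀ : Polynomial ℂ)
    (by rw [hdeg]; norm_num)
  refine ⟨z, ?_⟩
  simp only [Cubic.toPoly, Polynomial.IsRoot, Polynomial.eval_add, Polynomial.eval_mul,
    Polynomial.eval_X, Polynomial.eval_C, Polynomial.eval_pow] at hz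
  linear_combination hz

/-- A real quadratic whose complex roots all have nonpositive real part has nonnegative
coefficients. -/
theorem quadratic_coeff_nonneg {a b : ℝ}
    (h : ∀ z : ℂ, z ^ 2 + a * z + b = 0 → z.re ≤ 0) : 0 ≤ a ∧ 0 ≤ b := by
  obtain ⟨z, hz⟩ := exists_root_quadratic a b
  have h₁ := h z hz
  have h₂ := h (-a - z) (by linear_combination hz)
  have hre := congrArg Complex.re hz
  have him := congrArg Complex.im hz
  simp only [Complex.sub_re, Complex.neg_re, Complex.ofReal_re] at h₂
  simp only [pow_two, Complex.add_re, Complex.mul_re, Complex.ofReal_re, Complex.ofReal_im,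
    Complex.zero_re, Complex.add_im, Complex.mul_im, Complex.zero_im] at hre him
  refine ⟨by linarith, ?_⟩
  have hmul : z.im * (2 * z.re + a) = 0 := by linear_combination him
  rcases mul_eq_zero.mp hmul with hy | hx
  · rw [hy] at hre
    nlinarith [mul_nonneg_of_nonpos_of_nonpos h₁ h₂]
  · nlinarith [sq_nonneg z.re, sq_nonneg z.im]

/-- Every real monic quartic is a product of two real monic quadratics. -/
theorem quartic_eq_mul_quadratics (a₃ a₂ a₁ a₀ : ℝ) :
    ∃ m n c d : ℝ, a₃ = m + c ∧ a₂ = n + m * c + d ∧ a₁ = m * d + n * c ∧ a₀ = n * d := by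
  by_cases hreal : ∀ z : ℂ, z ^ 4 + a₃ * z ^ 3 + a₂ * z ^ 2 + a₁ * z + a₀ = 0 → z.im = 0
  · obtain ⟨z, hz⟩ := exists_root_quartic a₃ a₂ a₁ a₀
    obtain ⟨r, rfl⟩ : ∃ r : ℝ, z = r :=
      ⟨z.re, Complex.ext rfl (by simpa using hreal z hz)⟩
    obtain ⟨w, hw⟩ := exists_root_cubic (a₃ + r) (a₂ + r * (a₃ + r))
      (a₁ + r * (a₂ + r * (a₃ + r)))
    have hw' : w ^ 4 + a₃ * w ^ 3 + a₂ * w ^ 2 + a₁ * w + a₀ = 0 := by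
      linear_combination (w - r) * hw + hz
    obtain ⟨s, rfl⟩ : ∃ s : ℝ, w = s :=
      ⟨w.re, Complex.ext rfl (by simpa using hreal w hw')⟩
    norm_cast at hz hw
    exact ⟨-(r + s), r * s, a₃ + r + s, a₂ + r * (a₃ + r) + s * (a₃ + r + s), by ring, by ring,
      by linear_combination hw, by linear_combination hz - r * hw⟩
  · push Not at hreal
    obtain ⟨z, hz, hy⟩ := hreal
    obtain ⟨m, hm⟩ : ∃ m : ℝ, m = -2 * z.re := ⟨_, rfl⟩
    obtain ⟨n, hn⟩ : ∃ n : ℝ, n = z.re ^ 2 + z.im ^ 2 := ⟨_, rfl⟩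
    have hq : z ^ 2 + m * z + n = 0 := by
      apply Complex.ext
      · simp [pow_two, hm, hn]; ring
      · simp [pow_two, hm, hn]; ring
    obtain ⟨c, hc⟩ : ∃ c : ℝ, c = a₃ - m := ⟨_, rfl⟩
    obtain ⟨d, hd⟩ : ∃ d : ℝ, d = a₂ - n - m * c := ⟨_, rfl⟩
    have hc' : (c : ℂ) = a₃ - m := by exact_mod_cast hc
    have hd' : (d : ℂ) = a₂ - n - m * c := by exact_mod_cast hd
    have hrem : ((a₁ - m * d - n * c : ℝ) : ℂ) * z + ((a₀ - n * d : ℝ) : ℂ) = 0 := by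
      push_cast
      linear_combination hz - (z ^ 2 + c * z + d) * hq + z ^ 3 * hc' + z ^ 2 * hd'
    have him := congrArg Complex.im hrem
    have hre := congrArg Complex.re hrem
    simp only [Complex.add_im, Complex.im_ofReal_mul, Complex.ofReal_im, add_zero,
      Complex.zero_im] at him
    have hu := (mul_eq_zero.mp him).resolve_right hy
    simp only [hu, Complex.ofReal_zero, zero_mul, zero_add, Complex.ofReal_re,
      Complex.zero_re] at hre
    exact ⟨m, n, c, d, by linarith, by linarith, by linarith, by linarith⟩

/-- Routh–Hurwitz necessary conditions: a real monic quartic whose complex roots all have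
nonpositive real part has nonnegative linear coefficient and third Hurwitz determinant. -/
theorem quartic_hurwitz_nonneg {a₃ a₂ a₁ a₀ : ℝ}
    (h : ∀ z : ℂ, z ^ 4 + a₃ * z ^ 3 + a₂ * z ^ 2 + a₁ * z + a₀ = 0 → z.re ≤ 0) :
    0 ≤ a₁ ∧ 0 ≤ a₃ * a₂ * a₁ - a₁ ^ 2 - a₃ ^ 2 * a₀ := by
  obtain ⟨m, n, c, d, rfl, rfl, rfl, rfl⟩ := quartic_eq_mul_quadratics a₃ a₂ a₁ a₀
  push_cast at h
  obtain ⟨hm, hn⟩ := quadratic_coeff_nonneg (a := m) (b := n) fun z hz =>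
    h z (by linear_combination (z ^ 2 + c * z + d) * hz)
  obtain ⟨hc, hd⟩ := quadratic_coeff_nonneg (a := c) (b := d) fun z hz =>
    h z (by linear_combination (z ^ 2 + m * z + n) * hz)
  refine ⟨by positivity, ?_⟩
  have : (m + c) * (n + m * c + d) * (m * d + n * c) - (m * d + n * c) ^ 2 -
      (m + c) ^ 2 * (n * d) = m * c * ((n - d) ^ 2 + (m + c) * (m * d + n * c)) := by ring
  rw [this]
  positivity

/-- If the friction-weighted combination `(q - J₂) p R₁ + (p - J₁) q R₂` is nonnegative, so is
`(q - J₂) R₁ J₁ + (p - J₁) R₂ J₂`. -/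
theorem rotor_combination_nonneg {p q J₁ J₂ R₁ R₂ : ℝ} (hp : 0 < p) (hq : 0 < q)
    (hJ₁ : 0 < J₁) (hJ₂ : 0 < J₂) (hR₁ : 0 < R₁) (hR₂ : 0 < R₂)
    (hc : 0 ≤ (q - J₂) * p * R₁ + (p - J₁) * q * R₂) :
    0 ≤ (q - J₂) * R₁ * J₁ + (p - J₁) * R₂ * J₂ := by
  rcases le_total 0 (q - J₂) with hα | hα <;> rcases le_total 0 (p - J₁) with hβ | hβ
  · positivity
  · have h₁ : p * J₂ ≤ J₁ * q := by nlinarith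
    refine nonneg_of_mul_nonneg_right (a := p) ?_ hp
    nlinarith [mul_nonneg hJ₁.le hc,
      mul_nonneg (mul_nonneg (neg_nonneg.mpr hβ) hR₂.le) (sub_nonneg.mpr h₁)]
  · have h₁ : J₁ * q ≤ p * J₂ := by nlinarith
    refine nonneg_of_mul_nonneg_right (a := q) ?_ hq
    nlinarith [mul_nonneg hJ₂.le hc,
      mul_nonneg (mul_nonneg (neg_nonneg.mpr hα) hR₁.le) (sub_nonneg.mpr h₁)]
  · have h₁ : q - J₂ = 0 ∧ p - J₁ = 0 := by
      have e₁ := mul_nonneg (mul_nonneg (neg_nonneg.mpr hα) hp.le) hR₁.le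
      have e₂ := mul_nonneg (mul_nonneg (neg_nonneg.mpr hβ) hq.le) hR₂.le
      have z₁ : (q - J₂) * (p * R₁) = 0 := by linarith
      have z₂ : (p - J₁) * (q * R₂) = 0 := by linarith
      exact ⟨(mul_eq_zero.mp z₁).resolve_right (by positivity),
        (mul_eq_zero.mp z₂).resolve_right (by positivity)⟩
    simp [h₁.1, h₁.2]

/-- **Rigid body with two internal rotors** (Example 1 of §6 of the paper). For a steady
minor-axis spin (`B₁ > B₂ > B₃`, `ω ≠ 0`) of a rigid body carrying two symmetric rotors
with inertias `J₁ > 0`, `J₂ > 0` (with `A₁ = B₁ − J₁ > 0`, `A₂ = B₂ − J₂ > 0`) and rotor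
dissipation coefficients `R₁, R₂ > 0`, the reduced linearized coefficient matrix has an
eigenvalue with strictly positive real part: dissipation-induced instability. -/
theorem rigid_body_with_rotors_instability
    (B₁ B₂ B₃ J₁ J₂ ω R₁ R₂ : ℝ)
    (h₁₂ : B₂ < B₁) (h₂₃ : B₃ < B₂)
    (hJ₁ : 0 < J₁) (hJ₂ : 0 < J₂)
    (hA₁ : 0 < B₁ - J₁) (hA₂ : 0 < B₂ - J₂)
    (hω : ω ≠ 0) (hR₁ : 0 < R₁) (hR₂ : 0 < R₂) :
    ∃ μ : ℂ,
      (((!![-R₁, -J₂ * ω / (B₁ - J₁), 0, (B₃ - B₂) * ω / (B₁ - J₁);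
            J₁ * ω / (B₂ - J₂), -R₂, (B₁ - B₃) * ω / (B₂ - J₂), 0;
            0, J₂ * ω / (B₁ - J₁), 0, (B₂ - B₃) * ω / (B₁ - J₁);
            -J₁ * ω / (B₂ - J₂), 0, (B₃ - B₁) * ω / (B₂ - J₂), 0] :
          Matrix (Fin 4) (Fin 4) ℝ).map Complex.ofReal).charpoly.IsRoot μ) ∧
      0 < μ.re := by
  by_contra! hstable
  obtain ⟨w, hw⟩ : ∃ w : ℝ, w = ω ^ 2 / ((B₁ - J₁) * (B₂ - J₂)) := ⟨_, rfl⟩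
  obtain ⟨p, hp⟩ : ∃ p : ℝ, p = B₁ - B₃ := ⟨_, rfl⟩
  obtain ⟨q, hq⟩ : ∃ q : ℝ, q = B₂ - B₃ := ⟨_, rfl⟩
  have hw₀ : 0 < w := by rw [hw]; positivity
  have hp₀ : 0 < p := by linarith
  have hq₀ : 0 < q := by linarith
  have hA₁' : (B₁ - J₁ : ℂ) ≠ 0 := by exact_mod_cast hA₁.ne'
  have hA₂' : (B₂ - J₂ : ℂ) ≠ 0 := by exact_mod_cast hA₂.ne'
  obtain ⟨hlin, hdet⟩ := quartic_hurwitz_nonneg (a₃ := R₁ + R₂)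
    (a₂ := R₁ * R₂ + w * ((q - J₂) * (p - J₁)))
    (a₁ := w * ((q - J₂) * p * R₁ + (p - J₁) * q * R₂))
    (a₀ := w * (p * q * R₁ * R₂)) (fun z hz => hstable z (by
      rw [Polynomial.IsRoot, Matrix.eval_charpoly, ← hz, hw, hp, hq]
      simp [Matrix.det_succ_row_zero, Fin.sum_univ_succ, Fin.succAbove]
      field_simp
      ring))
  have hc := nonneg_of_mul_nonneg_right hlin hw₀
  have hcomb := rotor_combination_nonneg hp₀ hq₀ hJ₁ hJ₂ hR₁ hR₂ hc
  have hprod := mul_nonneg (mul_nonneg hw₀.le hw₀.le) (mul_nonneg hc hcomb)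
  have hpos : 0 < w * ((R₁ + R₂) * (R₁ * R₂) * (p * J₂ * R₁ + q * J₁ * R₂)) := by positivity
  linarith
end
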